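/- Under the stated hypotheses (Hessian determinant bounds and ∇f a diffeomorphism onto its image), there is a constant C > 0 depending only on f and w such that for all Q ≥ 2 and all δ ∈ (0,1/2): N_S^w(Q,δ) ≤ C(δ Q^n + E_n(Q)), where E_3(Q) = Q² exp(c√(log Q)) and E_n(Q) = Q^{n-1}(log Q)^κ for n ≥ 4, with constants c, κ > 0 depending only on f and w. -/

import Mathlib

open MeasureTheory

/-- Distance from a real number to the nearest integer. -/
noncomputable def nint (θ : ℝ) : ℝ := |θ - round θ|

/-- Gradient of `f` at `x`. -/
noncomputable def gradv {m : ℕ} (f : (Fin m → ℝ) → ℝ) (x : Fin m → ℝ) : Fin m → ℝ :=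
  fun i => fderiv ℝ f x (Pi.single i 1)

/-- Hessian matrix of `f` at `x`. -/
noncomputable def hess {m : ℕ} (f : (Fin m → ℝ) → ℝ) (x : Fin m → ℝ) :
    Matrix (Fin m) (Fin m) ℝ :=
  Matrix.of fun i j => fderiv ℝ (fun y => fderiv ℝ f y (Pi.single j 1)) x (Pi.single i 1)

/-- The weighted counting function
`N_S^w(Q,δ) = ∑_{a ∈ ℤ^{m}, q ∈ ℤ, 1 ≤ q ≤ Q, ‖q f(a/q)‖ < δ} w(a/q)`. -/
noncomputable def NSw {m : ℕ} (f w : (Fin m → ℝ) → ℝ) (Q δ : ℝ) : ℝ :=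
  ∑ᶠ (q : ℤ) (a : Fin m → ℤ),
    if 1 ≤ q ∧ (q : ℝ) ≤ Q ∧ nint ((q : ℝ) * f (fun i => (a i : ℝ) / (q : ℝ))) < δ
      then w (fun i => (a i : ℝ) / (q : ℝ)) else 0

lemma sum_stdAddChar_dotProduct {d P : ℕ} [NeZero P] (z : Fin d → ZMod P) :
    ∑ u : Fin d → ZMod P, (ZMod.stdAddChar (u ⬝ᵥ z) : ℂ) = if z = 0 then (P : ℂ) ^ d else 0 := by
  have h1 : ∀ u : Fin d → ZMod P,
      (ZMod.stdAddChar (u ⬝ᵥ z) : ℂ) = ∏ i, ZMod.stdAddChar (u i * z i) := by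
    intro u
    exact map_prod (ZMod.stdAddChar (N := P)).toMonoidHom
      (fun i => Multiplicative.ofAdd (u i * z i)) Finset.univ
  simp_rw [h1]
  rw [← Fintype.piFinset_univ, ← Finset.prod_univ_sum (fun _ => Finset.univ)
    (fun i x => (ZMod.stdAddChar (x * z i) : ℂ))]
  simp_rw [AddChar.sum_mulShift _ (ZMod.isPrimitive_stdAddChar P)]
  split_ifs with h
  · subst h; simp [ZMod.card]
  · obtain ⟨i, hi⟩ := Function.ne_iff.1 h
    apply Finset.prod_eq_zero (Finset.mem_univ i)
    rw [if_neg (by simpa using hi), Nat.cast_zero]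

lemma sum_sq_norm_expSum {d P : ℕ} [NeZero P] (S : Finset (ZMod P × (Fin d → ZMod P))) :
    ∑ u : ZMod P × (Fin d → ZMod P),
      ‖∑ z ∈ S, (ZMod.stdAddChar (u.1 * z.1 + u.2 ⬝ᵥ z.2) : ℂ)‖ ^ 2 = (P : ℝ) ^ (d + 1) * S.card := by
  have key : ∀ z z' : ZMod P × (Fin d → ZMod P),
      ∑ u : ZMod P × (Fin d → ZMod P), (ZMod.stdAddChar (u.1 * z.1 + u.2 ⬝ᵥ z.2) : ℂ) *
        (starRingEnd ℂ) (ZMod.stdAddChar (u.1 * z'.1 + u.2 ⬝ᵥ z'.2) : ℂ) =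
        if z = z' then (P : ℂ) ^ (d + 1) else 0 := by
    intro z z'
    have : ∀ u : ZMod P × (Fin d → ZMod P),
        (ZMod.stdAddChar (u.1 * z.1 + u.2 ⬝ᵥ z.2) : ℂ) *
        (starRingEnd ℂ) (ZMod.stdAddChar (u.1 * z'.1 + u.2 ⬝ᵥ z'.2) : ℂ) =
        ZMod.stdAddChar (u.1 * (z.1 - z'.1)) * ZMod.stdAddChar (u.2 ⬝ᵥ (z.2 - z'.2)) := by
      intro u
      rw [← AddChar.inv_apply_eq_conj, ← AddChar.map_neg_eq_inv, ← AddChar.map_add_eq_mul,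
        ← AddChar.map_add_eq_mul, dotProduct_sub]
      congr 1
      ring
    simp_rw [this]
    rw [Fintype.sum_prod_type]
    simp only
    rw [← Finset.sum_mul_sum, sum_stdAddChar_dotProduct,
      AddChar.sum_mulShift _ (ZMod.isPrimitive_stdAddChar P)]
    rcases z with ⟨a, b⟩
    rcases z' with ⟨a', b'⟩
    simp only [Prod.mk.injEq, sub_eq_zero, ZMod.card]
    by_cases h : a = a' <;> by_cases h' : b = b' <;> simp [h, h', pow_succ, mul_comm]
  have : ∀ u : ZMod P × (Fin d → ZMod P),
      ((‖∑ z ∈ S, (ZMod.stdAddChar (u.1 * z.1 + u.2 ⬝ᵥ z.2) : ℂ)‖ ^ 2 : ℝ) : ℂ) =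
      ∑ z ∈ S, ∑ z' ∈ S, (ZMod.stdAddChar (u.1 * z.1 + u.2 ⬝ᵥ z.2) : ℂ) *
        (starRingEnd ℂ) (ZMod.stdAddChar (u.1 * z'.1 + u.2 ⬝ᵥ z'.2) : ℂ) := by
    intro u
    rw [Complex.ofReal_pow, ← Complex.mul_conj', map_sum, Finset.sum_mul_sum]
  have h2 : ((∑ u : ZMod P × (Fin d → ZMod P),
      ‖∑ z ∈ S, (ZMod.stdAddChar (u.1 * z.1 + u.2 ⬝ᵥ z.2) : ℂ)‖ ^ 2 : ℝ) : ℂ) =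
      ((P : ℝ) ^ (d + 1) * S.card : ℝ) := by
    rw [Complex.ofReal_sum]
    simp_rw [this]
    rw [Finset.sum_comm]
    have : ∀ z ∈ S, ∑ u : ZMod P × (Fin d → ZMod P), ∑ z' ∈ S,
        (ZMod.stdAddChar (u.1 * z.1 + u.2 ⬝ᵥ z.2) : ℂ) *
        (starRingEnd ℂ) (ZMod.stdAddChar (u.1 * z'.1 + u.2 ⬝ᵥ z'.2) : ℂ) = (P : ℂ) ^ (d + 1) := by
      intro z hz
      rw [Finset.sum_comm]
      simp_rw [key]
      simp [hz]
    rw [Finset.sum_congr rfl this]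
    simp [mul_comm]
  exact_mod_cast h2

lemma norm_sum_stdAddChar_ge {α : Type*} {P : ℕ} [NeZero P] (S : Finset α) (φ : α → ℤ)
    (h : ∀ z ∈ S, ∃ b : ℤ, |(φ z : ℝ) / P - b| ≤ 1 / 8) :
    (S.card : ℝ) / 2 ≤ ‖∑ z ∈ S, (ZMod.stdAddChar (φ z : ZMod P) : ℂ)‖ := by
  refine le_trans ?_ (Complex.re_le_norm _)
  rw [Complex.re_sum, div_eq_mul_one_div, ← nsmul_eq_mul]
  refine Finset.card_nsmul_le_sum _ _ _ fun z hz => ?_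
  obtain ⟨b, hb⟩ := h z hz
  rw [ZMod.stdAddChar_coe]
  have e : (2 * (Real.pi : ℂ) * Complex.I * (φ z : ℂ) / P) =
      ((2 * Real.pi * ((φ z : ℝ) / P) : ℝ) : ℂ) * Complex.I := by
    push_cast; ring
  rw [e, Complex.exp_ofReal_mul_I_re]
  have e2 : 2 * Real.pi * ((φ z : ℝ) / P) =
      2 * Real.pi * ((φ z : ℝ) / P - b) + b * (2 * Real.pi) := by ring
  rw [e2, Real.cos_add_int_mul_two_pi]
  refine le_trans ?_ Real.one_sub_sq_div_two_le_cos
  have h3 := Real.pi_lt_d2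
  have h4 := Real.pi_pos
  have h5 : (2 * Real.pi * ((φ z : ℝ) / P - b)) ^ 2 ≤ 1 := by
    rw [sq_le_one_iff_abs_le_one, abs_mul, abs_of_pos (by positivity)]
    nlinarith [abs_nonneg ((φ z : ℝ) / P - b)]
  linarith

/-- The integers within distance `e` of `x`. -/
noncomputable def intNear (x e : ℝ) : Finset ℤ := Finset.Icc ⌈x - e⌉ ⌊x + e⌋

lemma mem_intNear {x e : ℝ} {m : ℤ} : m ∈ intNear x e ↔ |(m : ℝ) - x| ≤ e := by
  rw [intNear, Finset.mem_Icc, Int.ceil_le, Int.le_floor, abs_le]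
  constructor <;> rintro ⟨h1, h2⟩ <;> constructor <;> linarith

lemma le_card_intNear {x e : ℝ} (he : 1 ≤ e) : e ≤ (intNear x e).card := by
  rw [intNear, Int.card_Icc]
  have h : ((⌊x + e⌋ + 1 - ⌈x - e⌉ : ℤ) : ℝ) ≤ ((⌊x + e⌋ + 1 - ⌈x - e⌉).toNat : ℤ) := by
    exact_mod_cast Int.self_le_toNat _
  push_cast at h
  have h1 := Int.lt_floor_add_one (x + e)
  have h2 := Int.ceil_lt_add_one (x - e)
  linarith

lemma card_intNear_le {x e : ℝ} (he : 0 ≤ e) : ((intNear x e).card : ℝ) ≤ 2 * e + 1 := by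
  rw [intNear, Int.card_Icc]
  have h1 := Int.floor_le (x + e)
  have h2 := Int.le_ceil (x - e)
  rcases le_total 0 (⌊x + e⌋ + 1 - ⌈x - e⌉) with h | h
  · have : (((⌊x + e⌋ + 1 - ⌈x - e⌉).toNat : ℤ) : ℝ) = ((⌊x + e⌋ + 1 - ⌈x - e⌉ : ℤ) : ℝ) := by
      exact_mod_cast Int.toNat_of_nonneg h
    push_cast at this
    rw [this]
    linarith
  · rw [Int.toNat_of_nonpos h]
    push_cast
    linarith

lemma abs_sum_mul_le {d : ℕ} {x y : Fin d → ℝ} {a b : ℝ} (ha : 0 ≤ a) (hx : ∀ i, |x i| ≤ a)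
    (hy : ∀ i, |y i| ≤ b) : |∑ i, x i * y i| ≤ d * (a * b) := by
  refine (Finset.abs_sum_le_sum_abs _ _).trans ?_
  refine (Finset.sum_le_card_nsmul _ _ (a * b) fun i _ => ?_).trans ?_
  · rw [abs_mul]
    exact mul_le_mul (hx i) (hy i) (abs_nonneg _) ha
  · simp

theorem exists_dual_finset {d : ℕ} (x₀ x₁ : Fin d → ℝ) (v Q A : ℝ) (hQ : 1 ≤ Q) (hA : 1 ≤ A)
    (H : ℕ) (hH : 1 ≤ H) (S : Finset (ℤ × (Fin d → ℤ)))
    (hS : ∀ p ∈ S, |(p.1 : ℝ)| ≤ Q ∧ (∀ i, |(p.2 i : ℝ) - p.1 * x₀ i| ≤ A) ∧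
      ∃ b : ℤ, |p.1 * v + ∑ i, x₁ i * (p.2 i - p.1 * x₀ i) - b| ≤ 1 / (16 * H)) :
    ∃ T : Finset (ℤ × (Fin d → ℤ) × ℤ), (∀ t ∈ T, |(t.1 : ℝ)| ≤ H ∧
      (∀ i, |(t.2.1 i : ℝ) - t.1 * x₁ i| ≤ 1 / (8 * (d + 1)) / A) ∧
      |t.2.2 + ∑ i, t.2.1 i * x₀ i - t.1 * v| ≤ 1 / (8 * (d + 1)) / Q) ∧
      (S.card : ℝ) * H ≤ 4 * (16 * (d + 1)) ^ (d + 1) * (A ^ d * Q) * T.card := by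
  classical
  set c : ℝ := 1 / (16 * (d + 1)) with hc
  have hc0 : 0 < c := by positivity
  have hcd : c * (d + 1) = 1 / 16 := by rw [hc]; field_simp
  have h2c : (1 : ℝ) / (8 * (d + 1)) = 2 * c := by rw [hc]; field_simp; norm_num
  obtain ⟨M, hM⟩ : ∃ M : ℕ, ∀ p ∈ S, p.1.natAbs ≤ M ∧ ∀ i, (p.2 i).natAbs ≤ M := by
    refine ⟨∑ p ∈ S, (p.1.natAbs + ∑ i, (p.2 i).natAbs), fun p hp => ?_⟩
    have h1 : p.1.natAbs + ∑ i, (p.2 i).natAbs ≤ ∑ p ∈ S, (p.1.natAbs + ∑ i, (p.2 i).natAbs) :=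
      Finset.single_le_sum (f := fun p : ℤ × (Fin d → ℤ) => p.1.natAbs + ∑ i, (p.2 i).natAbs)
        (fun _ _ => Nat.zero_le _) hp
    refine ⟨by omega, fun i => ?_⟩
    have h2 : (p.2 i).natAbs ≤ ∑ i, (p.2 i).natAbs :=
      Finset.single_le_sum (f := fun i => (p.2 i).natAbs) (fun _ _ => Nat.zero_le _)
        (Finset.mem_univ i)
    omega
  obtain ⟨P, hP1, hP2, hP3⟩ : ∃ P : ℕ, 2 * M < P ∧ A / c ≤ P ∧ Q / c ≤ P := by
    refine ⟨max (2 * M + 1) (max ⌈A / c⌉₊ ⌈Q / c⌉₊), ?_, ?_, ?_⟩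
    · exact lt_of_lt_of_le (Nat.lt_succ_self _) (le_max_left _ _)
    · refine (Nat.le_ceil _).trans ?_
      exact_mod_cast (le_max_left _ _).trans (le_max_right _ _)
    · refine (Nat.le_ceil _).trans ?_
      exact_mod_cast (le_max_right _ _).trans (le_max_right _ _)
  have hPpos : 0 < P := by omega
  have : NeZero P := ⟨hPpos.ne'⟩
  have hPR : (0 : ℝ) < P := by exact_mod_cast hPpos
  have hPA : 1 ≤ P * c / A := by
    rw [le_div_iff₀ (by linarith), one_mul]
    rwa [div_le_iff₀ hc0] at hP2
  have hPQ : 1 ≤ P * c / Q := by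
    rw [le_div_iff₀ (by linarith), one_mul]
    rwa [div_le_iff₀ hc0] at hP3
  -- reduction modulo `P`
  let ρ : ℤ × (Fin d → ℤ) → ZMod P × (Fin d → ZMod P) := fun p => (p.1, fun i => (p.2 i : ZMod P))
  have hρ : Set.InjOn ρ S := by
    have aux : ∀ a b : ℤ, a.natAbs ≤ M → b.natAbs ≤ M → (a : ZMod P) = b → a = b := by
      intro a b ha hb hab
      rw [ZMod.intCast_eq_intCast_iff_dvd_sub] at hab
      have : b - a = 0 := Int.eq_zero_of_abs_lt_dvd hab (by rw [abs_lt]; omega)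
      omega
    intro p hp p' hp' h
    obtain ⟨h1, h2⟩ := Prod.ext_iff.1 h
    refine Prod.ext (aux _ _ (hM p hp).1 (hM p' hp').1 h1) (funext fun i => ?_)
    exact aux _ _ ((hM p hp).2 i) ((hM p' hp').2 i) (congrFun h2 i)
  -- the family of frequencies
  let Ba : ℤ → Finset (Fin d → ℤ) := fun j =>
    Fintype.piFinset fun i => intNear (P * (j * x₁ i)) (P * c / A)
  let Bq : ℤ → (Fin d → ℤ) → Finset ℤ := fun j a =>
    intNear (P * (j * v) - ∑ i, a i * x₀ i) (P * c / Q)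
  let B : Finset (Σ _ : ℤ, Σ _ : Fin d → ℤ, ℤ) :=
    (Finset.Icc (1 : ℤ) H).sigma fun j => (Ba j).sigma fun a => Bq j a
  have hBcard : H * ((P * c / A) ^ d * (P * c / Q)) ≤ (B.card : ℝ) := by
    rw [Finset.card_sigma, Nat.cast_sum]
    have : (H : ℝ) * ((P * c / A) ^ d * (P * c / Q)) =
        (Finset.Icc (1 : ℤ) H).card • ((P * c / A) ^ d * (P * c / Q)) := by simp
    rw [this]
    refine Finset.card_nsmul_le_sum _ _ _ fun j _ => ?_
    rw [Finset.card_sigma, Nat.cast_sum]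
    have h1 : (P * c / A) ^ d ≤ ((Ba j).card : ℝ) := by
      rw [Fintype.card_piFinset, Nat.cast_prod]
      calc (P * c / A) ^ d = ∏ _i : Fin d, (P * c / A) := by
            rw [Finset.prod_const, Finset.card_univ, Fintype.card_fin]
        _ ≤ _ := Finset.prod_le_prod (fun i _ => by linarith) fun i _ => le_card_intNear hPA
    calc (P * c / A) ^ d * (P * c / Q) ≤ (Ba j).card * (P * c / Q) := by gcongr
      _ = (Ba j).card • (P * c / Q) := by simp
      _ ≤ _ := Finset.card_nsmul_le_sum _ _ _ fun a _ => le_card_intNear hPQ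
  let π : (Σ _ : ℤ, Σ _ : Fin d → ℤ, ℤ) → ZMod P × (Fin d → ZMod P) :=
    fun b => (b.2.2, fun i => (b.2.1 i : ZMod P))
  have hB : ∀ b ∈ B, (1 ≤ b.1 ∧ b.1 ≤ H) ∧ (∀ i, |(b.2.1 i : ℝ) - P * (b.1 * x₁ i)| ≤ P * c / A) ∧
      |(b.2.2 : ℝ) - (P * (b.1 * v) - ∑ i, b.2.1 i * x₀ i)| ≤ P * c / Q := by
    intro b hb
    simpa only [B, Ba, Bq, Finset.mem_sigma, Finset.mem_Icc, Fintype.mem_piFinset, mem_intNear]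
      using hb
  let V : ZMod P × (Fin d → ZMod P) → ℝ := fun u =>
    ‖∑ z ∈ S.image ρ, (ZMod.stdAddChar (u.1 * z.1 + u.2 ⬝ᵥ z.2) : ℂ)‖ ^ 2
  have hV : ∑ u, V u = (P : ℝ) ^ (d + 1) * S.card := by
    rw [sum_sq_norm_expSum, Finset.card_image_of_injOn hρ]
  have hVB : ∀ b ∈ B, ((S.card : ℝ) / 2) ^ 2 ≤ V (π b) := by
    intro b hb
    obtain ⟨⟨hb1, hb2⟩, hb3, hb4⟩ := hB b hb
    refine pow_le_pow_left₀ (by positivity) ?_ 2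
    rw [Finset.sum_image hρ]
    refine (norm_sum_stdAddChar_ge (P := P) S (fun p => b.2.2 * p.1 + ∑ i, b.2.1 i * p.2 i)
      ?_).trans (le_of_eq ?_)
    · intro p hp
      obtain ⟨hp1, hp2, n, hp3⟩ := hS p hp
      refine ⟨b.1 * n, ?_⟩
      have e1 : ((b.2.2 * p.1 + ∑ i, b.2.1 i * p.2 i : ℤ) : ℝ) / P - ((b.1 * n : ℤ) : ℝ) =
          b.1 * (p.1 * v + ∑ i, x₁ i * (p.2 i - p.1 * x₀ i) - n)
          + ((b.2.2 : ℝ) - (P * (b.1 * v) - ∑ i, b.2.1 i * x₀ i)) / P * p.1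
          + ∑ i, ((b.2.1 i : ℝ) - P * (b.1 * x₁ i)) / P * ((p.2 i : ℝ) - p.1 * x₀ i) := by
        have e2 : ∑ i, ((b.2.1 i : ℝ) - P * (b.1 * x₁ i)) / P * ((p.2 i : ℝ) - p.1 * x₀ i) =
            (∑ i, (b.2.1 i : ℝ) * p.2 i) / P - (∑ i, (b.2.1 i : ℝ) * x₀ i) / P * p.1
            - b.1 * ∑ i, x₁ i * (p.2 i - p.1 * x₀ i) := by
          rw [Finset.sum_div, Finset.sum_div, Finset.sum_mul, Finset.mul_sum,
            ← Finset.sum_sub_distrib, ← Finset.sum_sub_distrib]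
          refine Finset.sum_congr rfl fun i _ => ?_
          field_simp
        rw [e2]
        push_cast
        field_simp
        ring
      rw [e1]
      have f1 : |(b.1 : ℝ) * (p.1 * v + ∑ i, x₁ i * (p.2 i - p.1 * x₀ i) - n)| ≤ 1 / 16 := by
        rw [abs_mul, abs_of_nonneg (by exact_mod_cast (by omega : (0 : ℤ) ≤ b.1))]
        have hbH : (b.1 : ℝ) ≤ H := by exact_mod_cast hb2
        have hH' : (0 : ℝ) < H := by exact_mod_cast hH
        calc (b.1 : ℝ) * _ ≤ H * (1 / (16 * H)) := by gcongr
          _ = 1 / 16 := by field_simp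
      have f2 : |((b.2.2 : ℝ) - (P * (b.1 * v) - ∑ i, b.2.1 i * x₀ i)) / P * p.1| ≤ c := by
        rw [abs_mul, abs_div, abs_of_pos hPR]
        calc _ ≤ (P * c / Q) / P * Q := by gcongr
          _ = c := by field_simp
      have f3 : |∑ i, ((b.2.1 i : ℝ) - P * (b.1 * x₁ i)) / P * ((p.2 i : ℝ) - p.1 * x₀ i)|
          ≤ d * c := by
        refine (abs_sum_mul_le (a := c / A) (b := A) (by positivity) (fun i => ?_)
          (fun i => hp2 i)).trans (le_of_eq (by field_simp))
        rw [abs_div, abs_of_pos hPR, div_le_iff₀ hPR]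
        exact (hb3 i).trans (le_of_eq (by ring))
      refine (abs_add_three _ _ _).trans ?_
      linarith
    · refine congrArg _ (Finset.sum_congr rfl fun p _ => ?_)
      congr 1
      simp [π, ρ, dotProduct]
  -- differences of congruent frequencies
  let τ : (Σ _ : ℤ, Σ _ : Fin d → ℤ, ℤ) × (Σ _ : ℤ, Σ _ : Fin d → ℤ, ℤ) →
      ℤ × (Fin d → ℤ) × ℤ := fun b =>
    (b.1.1 - b.2.1, (fun i => (b.1.2.1 i - b.2.2.1 i) / P), (b.1.2.2 - b.2.2.2) / P)
  let R := (B ×ˢ B).filter fun b => π b.1 = π b.2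
  have hR : ∀ b ∈ R, (∀ i, b.1.2.1 i - b.2.2.1 i = P * (τ b).2.1 i) ∧
      b.1.2.2 - b.2.2.2 = P * (τ b).2.2 := by
    intro b hb
    have hb' := (Finset.mem_filter.1 hb).2
    obtain ⟨h1, h2⟩ := Prod.ext_iff.1 hb'
    have aux : ∀ a b : ℤ, (a : ZMod P) = b → a - b = P * ((a - b) / P) := by
      intro a b hab
      rw [eq_comm, ZMod.intCast_eq_intCast_iff_dvd_sub] at hab
      exact (Int.mul_ediv_cancel' hab).symm
    exact ⟨fun i => aux _ _ (congrFun h2 i), aux _ _ h1⟩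
  have hfib : ∀ u, ((B.filter fun b => π b = u).card : ℝ) ≤ (R.image τ).card := by
    intro u
    rcases (B.filter fun b => π b = u).eq_empty_or_nonempty with h | ⟨b₀, hb₀⟩
    · rw [h]; simp
    · have hb₀' := Finset.mem_filter.1 hb₀
      have hmem : ∀ b ∈ B.filter (fun b => π b = u), (b, b₀) ∈ R := by
        intro b hb
        have hb' := Finset.mem_filter.1 hb
        exact Finset.mem_filter.2 ⟨Finset.mk_mem_product hb'.1 hb₀'.1, hb'.2.trans hb₀'.2.symm⟩
      refine Nat.cast_le.2 (Finset.card_le_card_of_injOn (fun b => τ (b, b₀)) ?_ ?_)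
      · intro b hb
        exact Finset.mem_coe.2 (Finset.mem_image_of_mem _ (hmem b hb))
      · intro b hb b' hb' h
        have g := hR _ (hmem b hb)
        have g' := hR _ (hmem b' hb')
        simp only at h
        rw [h] at g
        have k1 : b.1 = b'.1 := by
          have := (Prod.ext_iff.1 h).1
          simp only [τ] at this
          omega
        have k2 : b.2.1 = b'.2.1 := funext fun i => by
          have := (g.1 i).trans (g'.1 i).symm
          simp only at this
          omega
        have k3 : b.2.2 = b'.2.2 := by
          have := g.2.trans g'.2.symm
          simp only at this
          omega
        obtain ⟨b1, b2, b3⟩ := b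
        obtain ⟨c1, c2, c3⟩ := b'
        simp only at k1 k2 k3
        subst k1 k2 k3
        rfl
  refine ⟨R.image τ, ?_, ?_⟩
  · intro t ht
    obtain ⟨b, hb, rfl⟩ := Finset.mem_image.1 ht
    obtain ⟨g1, g2⟩ := hR b hb
    obtain ⟨hb1, hb2⟩ := Finset.mem_product.1 (Finset.mem_filter.1 hb).1
    obtain ⟨⟨p1, p2⟩, p3, p4⟩ := hB _ hb1
    obtain ⟨⟨q1, q2⟩, q3, q4⟩ := hB _ hb2
    have g1' : ∀ i, (b.1.2.1 i : ℝ) - b.2.2.1 i = P * ((τ b).2.1 i : ℝ) := fun i => by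
      exact_mod_cast g1 i
    have g2' : (b.1.2.2 : ℝ) - b.2.2.2 = P * ((τ b).2.2 : ℝ) := by exact_mod_cast g2
    have g0 : ((τ b).1 : ℝ) = b.1.1 - b.2.1 := by simp [τ]
    refine ⟨?_, fun i => ?_, ?_⟩
    · have : |(τ b).1| ≤ H := by
        simp only [τ]
        rw [abs_le]
        omega
      exact_mod_cast this
    · have e : ((τ b).2.1 i : ℝ) - (τ b).1 * x₁ i =
          (((b.1.2.1 i : ℝ) - P * (b.1.1 * x₁ i)) - ((b.2.2.1 i : ℝ) - P * (b.2.1 * x₁ i))) / P := by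
        rw [eq_div_iff hPR.ne', g0]
        linear_combination -(g1' i)
      rw [e, abs_div, abs_of_pos hPR, div_le_iff₀ hPR, h2c]
      refine (abs_sub _ _).trans ?_
      have := p3 i
      have := q3 i
      have e : 2 * c / A * P = P * c / A + P * c / A := by ring
      linarith
    · have e : ((τ b).2.2 : ℝ) + ∑ i, (τ b).2.1 i * x₀ i - (τ b).1 * v =
          (((b.1.2.2 : ℝ) - (P * (b.1.1 * v) - ∑ i, b.1.2.1 i * x₀ i))
            - ((b.2.2.2 : ℝ) - (P * (b.2.1 * v) - ∑ i, b.2.2.1 i * x₀ i))) / P := by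
        have : ∑ i, (b.1.2.1 i : ℝ) * x₀ i - ∑ i, (b.2.2.1 i : ℝ) * x₀ i =
            P * ∑ i, ((τ b).2.1 i : ℝ) * x₀ i := by
          rw [Finset.mul_sum, ← Finset.sum_sub_distrib]
          refine Finset.sum_congr rfl fun i _ => ?_
          linear_combination (g1' i) * x₀ i
        rw [eq_div_iff hPR.ne', g0]
        linear_combination -g2' - this
      rw [e, abs_div, abs_of_pos hPR, div_le_iff₀ hPR, h2c]
      refine (abs_sub _ _).trans ?_
      have e : 2 * c / Q * P = P * c / Q + P * c / Q := by ring
      linarith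
  · have h1 : (B.card : ℝ) * (S.card / 2) ^ 2 ≤ (R.image τ).card * (P ^ (d + 1) * S.card) := by
      calc (B.card : ℝ) * (S.card / 2) ^ 2 = B.card • ((S.card : ℝ) / 2) ^ 2 := by simp
        _ ≤ ∑ b ∈ B, V (π b) := Finset.card_nsmul_le_sum _ _ _ hVB
        _ = ∑ u, ∑ b ∈ B with π b = u, V (π b) := (Finset.sum_fiberwise _ _ _).symm
        _ = ∑ u, (B.filter fun b => π b = u).card * V u := by
          refine Finset.sum_congr rfl fun u _ => ?_
          rw [← nsmul_eq_mul, ← Finset.sum_const]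
          refine Finset.sum_congr rfl fun b hb => ?_
          rw [(Finset.mem_filter.1 hb).2]
        _ ≤ ∑ u, (R.image τ).card * V u := by
          refine Finset.sum_le_sum fun u _ => ?_
          exact mul_le_mul_of_nonneg_right (hfib u) (by positivity)
        _ = _ := by rw [← Finset.mul_sum, hV]
    set N : ℝ := ((R.image τ).card : ℝ)
    rcases Nat.eq_zero_or_pos S.card with h0 | h0
    · rw [h0]
      simp only [Nat.cast_zero, zero_mul]
      positivity
    · have hs : (0 : ℝ) < S.card := by exact_mod_cast h0
      have h2 : H * ((P * c / A) ^ d * (P * c / Q)) * S.card ≤ 4 * N * P ^ (d + 1) := by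
        have h3 : (B.card : ℝ) * S.card ≤ 4 * N * P ^ (d + 1) := by
          refine le_of_mul_le_mul_right ?_ hs
          linarith [h1, sq (S.card : ℝ)]
        exact (mul_le_mul_of_nonneg_right hBcard hs.le).trans h3
      have e1 : H * ((P * c / A) ^ d * (P * c / Q)) * S.card =
          (S.card * H) * (c ^ (d + 1) / (A ^ d * Q)) * P ^ (d + 1) := by
        rw [div_pow, mul_pow]
        field_simp
        ring
      rw [e1] at h2
      have h4 := le_of_mul_le_mul_right h2 (by positivity)
      have e2 : c ^ (d + 1) = 1 / (16 * (d + 1)) ^ (d + 1) := by rw [hc, one_div_pow]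
      rw [e2, div_div, mul_one_div, div_le_iff₀ (by positivity)] at h4
      calc _ ≤ _ := h4
        _ = _ := by ring

lemma int_eq_zero_of_abs_lt {k : ℤ} (h : |(k : ℝ)| < 1) : k = 0 := by
  have : |k| < 1 := by exact_mod_cast h
  exact Int.abs_lt_one_iff.1 this

theorem exists_pos_dual_finset {d : ℕ} (x₀ x₁ : Fin d → ℝ) (v Q A : ℝ) (hQ : 1 ≤ Q) (hA : 1 ≤ A)
    (H : ℕ) (hH : 1 ≤ H) (S : Finset (ℤ × (Fin d → ℤ)))
    (hS : ∀ p ∈ S, |(p.1 : ℝ)| ≤ Q ∧ (∀ i, |(p.2 i : ℝ) - p.1 * x₀ i| ≤ A) ∧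
      ∃ b : ℤ, |p.1 * v + ∑ i, x₁ i * (p.2 i - p.1 * x₀ i) - b| ≤ 1 / (16 * H)) :
    ∃ T : Finset (ℤ × (Fin d → ℤ) × ℤ), (∀ t ∈ T, 1 ≤ t.1 ∧ t.1 ≤ H ∧
      (∀ i, |(t.2.1 i : ℝ) - t.1 * x₁ i| ≤ 1 / (8 * (d + 1)) / A) ∧
      |t.2.2 + ∑ i, t.2.1 i * x₀ i - t.1 * v| ≤ 1 / (8 * (d + 1)) / Q) ∧
      (S.card : ℝ) * H ≤ 4 * (16 * (d + 1)) ^ (d + 1) * (A ^ d * Q) * (1 + 2 * T.card) := by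
  classical
  obtain ⟨T, hT, hcard⟩ := exists_dual_finset x₀ x₁ v Q A hQ hA H hH S hS
  set c : ℝ := 1 / (8 * (d + 1)) with hc
  have hc0 : 0 < c := by positivity
  have hc1 : c < 1 := by
    rw [hc, div_lt_one (by positivity)]
    have : (0 : ℝ) ≤ d := Nat.cast_nonneg d
    linarith
  have small : ∀ X : ℝ, 1 ≤ X → c / X < 1 := fun X hX => by
    rw [div_lt_one (by linarith)]
    linarith
  let neg : ℤ × (Fin d → ℤ) × ℤ → ℤ × (Fin d → ℤ) × ℤ := fun t => -t
  have hneg : Function.Injective neg := neg_injective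
  let T₁ := T.filter fun t => 0 < t.1
  let T₂ := (T.filter fun t => t.1 < 0).image neg
  refine ⟨T₁ ∪ T₂, ?_, hcard.trans ?_⟩
  · intro t ht
    rcases Finset.mem_union.1 ht with ht | ht
    · obtain ⟨ht, h0⟩ := Finset.mem_filter.1 ht
      obtain ⟨h1, h2, h3⟩ := hT t ht
      refine ⟨by omega, ?_, h2, h3⟩
      exact_mod_cast (le_abs_self _).trans h1
    · obtain ⟨s, hs, rfl⟩ := Finset.mem_image.1 ht
      obtain ⟨hs, h0⟩ := Finset.mem_filter.1 hs
      obtain ⟨h1, h2, h3⟩ := hT s hs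
      refine ⟨by simp only [neg, Prod.fst_neg]; omega, ?_, fun i => ?_, ?_⟩
      · have := (neg_le_abs _).trans h1
        simp only [neg, Prod.fst_neg]
        exact_mod_cast this
      · rw [← abs_neg]
        refine le_trans (le_of_eq (congrArg _ ?_)) (h2 i)
        simp [neg]
        ring
      · rw [← abs_neg]
        refine le_trans (le_of_eq (congrArg _ ?_)) h3
        simp [neg]
        ring
  · have hzero : ∀ t ∈ T.filter (fun t => t.1 = 0), t = 0 := by
      intro t ht
      obtain ⟨ht, h0⟩ := Finset.mem_filter.1 ht
      obtain ⟨h1, h2, h3⟩ := hT t ht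
      have hk : t.2.1 = 0 := funext fun i => by
        refine int_eq_zero_of_abs_lt ?_
        have := h2 i
        rw [h0] at this
        simp only [Int.cast_zero, zero_mul, sub_zero] at this
        exact this.trans_lt (small A hA)
      have hm : t.2.2 = 0 := by
        refine int_eq_zero_of_abs_lt ?_
        rw [h0, hk] at h3
        simp only [Pi.zero_apply, Int.cast_zero, zero_mul, sub_zero, Finset.sum_const_zero,
          add_zero] at h3
        exact h3.trans_lt (small Q hQ)
      exact Prod.ext h0 (Prod.ext hk hm)
    have h1 : (T.filter fun t => t.1 = 0).card ≤ 1 :=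
      Finset.card_le_one.2 fun a ha b hb => (hzero a ha).trans (hzero b hb).symm
    have h2 : T₁.card ≤ (T₁ ∪ T₂).card := Finset.card_le_card Finset.subset_union_left
    have h3 : T₂.card ≤ (T₁ ∪ T₂).card := Finset.card_le_card Finset.subset_union_right
    have h4 : T₂.card = (T.filter fun t => t.1 < 0).card := Finset.card_image_of_injective _ hneg
    have h5 : T ⊆ (T.filter fun t => t.1 = 0) ∪ (T₁ ∪ (T.filter fun t => t.1 < 0)) := by
      intro t ht
      simp only [T₁, Finset.mem_union, Finset.mem_filter, ht, true_and]
      omega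
    have h6 := Finset.card_le_card h5
    have h7 := Finset.card_union_le (T.filter fun t => t.1 = 0) (T₁ ∪ (T.filter fun t => t.1 < 0))
    have h8 := Finset.card_union_le T₁ (T.filter fun t => t.1 < 0)
    have h9 : T.card ≤ 1 + 2 * (T₁ ∪ T₂).card := by omega
    have h10 : (T.card : ℝ) ≤ 1 + 2 * (T₁ ∪ T₂).card := by exact_mod_cast h9
    gcongr

/-- `F` is a bi-Lipschitz bijection which is the gradient of `f`, quantitatively with constant `L`. -/
structure IsGradientPair {d : ℕ} (L : ℝ) (f : (Fin d → ℝ) → ℝ) (F : (Fin d → ℝ) → Fin d → ℝ) :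
    Prop where
  surj : Function.Surjective F
  lip : ∀ x y, ‖F y - F x‖ ≤ L * ‖y - x‖
  antilip : ∀ x y, ‖y - x‖ ≤ L * ‖F y - F x‖
  taylor : ∀ x y, |f y - f x - ∑ i, F x i * (y i - x i)| ≤ L * ‖y - x‖ ^ 2
  taylor_image : ∀ x y, |f y - f x - ∑ i, F x i * (y i - x i)| ≤ L * ‖F y - F x‖ ^ 2

lemma IsGradientPair.exists_legendre {d : ℕ} {L : ℝ} {f : (Fin d → ℝ) → ℝ}
    {F : (Fin d → ℝ) → Fin d → ℝ} (h : IsGradientPair L f F) :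
    ∃ (g : (Fin d → ℝ) → ℝ) (G : (Fin d → ℝ) → Fin d → ℝ), IsGradientPair L g G ∧
      (∀ ξ, F (G ξ) = ξ) ∧ ∀ ξ, g ξ = ∑ i, ξ i * G ξ i - f (G ξ) := by
  choose G hG using h.surj
  have hinj : Function.Injective F := fun x y hxy => by
    have := h.antilip y x
    rw [hxy, sub_self, norm_zero, mul_zero] at this
    exact sub_eq_zero.1 (norm_le_zero_iff.1 this)
  have key : ∀ ξ η, (∑ i, η i * G η i - f (G η)) - (∑ i, ξ i * G ξ i - f (G ξ))
      - ∑ i, G ξ i * (η i - ξ i) = f (G ξ) - f (G η) - ∑ i, F (G η) i * (G ξ i - G η i) := by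
    intro ξ η
    have : ∑ i, η i * G η i - ∑ i, ξ i * G ξ i - ∑ i, G ξ i * (η i - ξ i) =
        - ∑ i, F (G η) i * (G ξ i - G η i) := by
      rw [hG, ← Finset.sum_sub_distrib, ← Finset.sum_sub_distrib, ← Finset.sum_neg_distrib]
      exact Finset.sum_congr rfl fun i _ => by ring
    linear_combination this
  refine ⟨fun ξ => ∑ i, ξ i * G ξ i - f (G ξ), G, ⟨fun x => ⟨F x, hinj (hG _)⟩, ?_, ?_, ?_, ?_⟩,
    hG, fun _ => rfl⟩
  · intro ξ η
    simpa only [hG] using h.antilip (G ξ) (G η)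
  · intro ξ η
    simpa only [hG] using h.lip (G ξ) (G η)
  · intro ξ η
    rw [key]
    refine (h.taylor_image _ _).trans (le_of_eq ?_)
    rw [hG, hG, norm_sub_rev]
  · intro ξ η
    rw [key]
    refine (h.taylor _ _).trans (le_of_eq ?_)
    rw [norm_sub_rev]

lemma card_le_of_forall_near {d : ℕ} {U : Finset (Fin d → ℤ)} {x : Fin d → ℝ} {e : ℝ} (he : 0 ≤ e)
    (h : ∀ u ∈ U, ∀ i, |(u i : ℝ) - x i| ≤ e) : (U.card : ℝ) ≤ (2 * e + 1) ^ d := by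
  classical
  have hsub : U ⊆ Fintype.piFinset fun i => intNear (x i) e := fun u hu =>
    Fintype.mem_piFinset.2 fun i => mem_intNear.2 (h u hu i)
  calc (U.card : ℝ) ≤ (Fintype.piFinset fun i => intNear (x i) e).card := by
        exact_mod_cast Finset.card_le_card hsub
    _ = ∏ i, ((intNear (x i) e).card : ℝ) := by rw [Fintype.card_piFinset, Nat.cast_prod]
    _ ≤ ∏ _i : Fin d, (2 * e + 1) :=
        Finset.prod_le_prod (fun _ _ => Nat.cast_nonneg _) fun i _ => card_intNear_le he
    _ = _ := by rw [Finset.prod_const, Finset.card_univ, Fintype.card_fin]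

/-- The number of grid points close to a level set near the critical point of `f - ξ`, at which
one partial derivative is large. -/
lemma card_level_partial_le {d : ℕ} {L : ℝ} (hL : 1 ≤ L) {C₁ C₃ : ℝ} (hC₁ : 0 ≤ C₁) (hC₃ : 0 ≤ C₃)
    {f : (Fin d → ℝ) → ℝ} {F : (Fin d → ℝ) → Fin d → ℝ} (h : IsGradientPair L f F)
    (ξ x : Fin d → ℝ) {r ν : ℝ} (hr : 0 < r) (hν : 1 ≤ ν) (v : ℝ) (i : Fin d)
    (U : Finset (Fin d → ℤ))
    (hU : ∀ u ∈ U, (∀ k, |r * u k - x k| ≤ C₁ * ν ^ 4 * r) ∧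
      |f (fun k => r * u k) - ∑ k, ξ k * (r * u k) - v| ≤ C₃ * ν ^ 4 * r ^ 2 ∧
      ν ^ 3 * r ≤ |F (fun k => r * u k) i - ξ i|) :
    (U.card : ℝ) ≤ (8 * C₃ + 1) * (4 * L * C₁ + 3) * (2 * C₁ + 1) ^ (d - 1) * ν ^ 2 *
      (ν ^ 4) ^ (d - 1) := by
  classical
  have hν0 : 0 < ν := by linarith
  have hL0 : 0 < L := by linarith
  set ℓ : ℝ := ν ^ 3 / (2 * L) with hℓ
  have hℓ0 : 0 < ℓ := by positivity
  have hν4 : 1 ≤ ν ^ 4 := one_le_pow₀ hν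
  let φ : (Fin d → ℤ) → Fin d → ℤ := fun u => Function.update u i ⌊u i / ℓ⌋
  let box : Fin d → Finset ℤ := Function.update (fun k => intNear (x k / r) (C₁ * ν ^ 4)) i
    (intNear (x i / r / ℓ) (C₁ * ν ^ 4 / ℓ + 1))
  have hnear : ∀ u ∈ U, ∀ k, |(u k : ℝ) - x k / r| ≤ C₁ * ν ^ 4 := by
    intro u hu k
    have e : (u k : ℝ) - x k / r = (r * u k - x k) / r := by field_simp
    rw [e, abs_div, abs_of_pos hr, div_le_iff₀ hr]
    exact (hU u hu).1 k
  have himg : (U.image φ).card ≤ (4 * L * C₁ + 3) * ν * ((2 * C₁ + 1) * ν ^ 4) ^ (d - 1) := by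
    have hsub : U.image φ ⊆ Fintype.piFinset box := by
      intro w hw
      obtain ⟨u, hu, rfl⟩ := Finset.mem_image.1 hw
      refine Fintype.mem_piFinset.2 fun k => ?_
      by_cases hk : k = i
      · subst hk
        simp only [φ, box, Function.update_self]
        rw [mem_intNear]
        have h1 := hnear u hu k
        have h2 : |(u k : ℝ) / ℓ - x k / r / ℓ| ≤ C₁ * ν ^ 4 / ℓ := by
          rw [← sub_div, abs_div, abs_of_pos hℓ0]
          gcongr
        have h3 := Int.floor_le ((u k : ℝ) / ℓ)
        have h4 := Int.lt_floor_add_one ((u k : ℝ) / ℓ)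
        rw [abs_le] at h2 ⊢
        constructor <;> linarith
      · simp only [φ, box, Function.update_of_ne hk]
        exact mem_intNear.2 (hnear u hu k)
    have h1 : ((U.image φ).card : ℝ) ≤ ∏ k, ((box k).card : ℝ) := by
      rw [← Nat.cast_prod, ← Fintype.card_piFinset]
      exact_mod_cast Finset.card_le_card hsub
    have h2 : ∏ k, ((box k).card : ℝ) ≤
        ∏ k, Function.update (fun _ => (2 * C₁ + 1) * ν ^ 4) i ((4 * L * C₁ + 3) * ν) k := by
      refine Finset.prod_le_prod (fun _ _ => Nat.cast_nonneg _) fun k _ => ?_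
      by_cases hk : k = i
      · subst hk
        simp only [box, Function.update_self]
        refine (card_intNear_le (by positivity)).trans ?_
        have e : C₁ * ν ^ 4 / ℓ = 2 * L * C₁ * ν := by
          rw [hℓ]
          field_simp
        rw [e]
        linarith
      · simp only [box, Function.update_of_ne hk]
        refine (card_intNear_le (by positivity)).trans ?_
        linarith
    refine h1.trans (h2.trans (le_of_eq ?_))
    rw [Finset.prod_update_of_mem (Finset.mem_univ i), Finset.prod_const, Finset.card_sdiff,
      Finset.inter_univ, Finset.card_univ, Fintype.card_fin, Finset.card_singleton]
  have hfib : ∀ w ∈ U.image φ, ((U.filter fun u => φ u = w).card : ℝ) ≤ (8 * C₃ + 1) * ν := by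
    intro w hw
    obtain ⟨u₀, hu₀, rfl⟩ := Finset.mem_image.1 hw
    have hout : ∀ u, φ u = φ u₀ → ∀ k, k ≠ i → u k = u₀ k := by
      intro u hu k hk
      have := congrFun hu k
      simpa only [φ, Function.update_of_ne hk] using this
    have hin : ∀ u ∈ U.filter (fun u => φ u = φ u₀), u i ∈ intNear (u₀ i) (4 * C₃ * ν) := by
      intro u hu
      obtain ⟨huU, hφ⟩ := Finset.mem_filter.1 hu
      have hfl : ⌊(u i : ℝ) / ℓ⌋ = ⌊(u₀ i : ℝ) / ℓ⌋ := by
        have := congrFun hφ i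
        simpa only [φ, Function.update_self] using this
      rw [mem_intNear]
      have hd1 : |(u i : ℝ) - u₀ i| ≤ ℓ := by
        have := Int.abs_sub_lt_one_of_floor_eq_floor hfl
        rw [← sub_div, abs_div, abs_of_pos hℓ0, div_lt_one hℓ0] at this
        exact this.le
      set s : ℝ := r * ((u i : ℝ) - u₀ i) with hs
      have hsum : ∀ c : Fin d → ℝ, ∑ k, c k * (r * u k - r * u₀ k) = c i * s := by
        intro c
        rw [Finset.sum_eq_single i]
        · rw [hs]; ring
        · intro k _ hk
          rw [hout u hφ k hk]; ring
        · simp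
      have hnorm : ‖(fun k => r * (u k : ℝ)) - fun k => r * (u₀ k : ℝ)‖ ≤ |s| := by
        rw [pi_norm_le_iff_of_nonneg (abs_nonneg _)]
        intro k
        by_cases hk : k = i
        · subst hk
          rw [Pi.sub_apply, Real.norm_eq_abs, hs, mul_sub]
        · rw [Pi.sub_apply, hout u hφ k hk, sub_self, norm_zero]
          exact abs_nonneg _
      have ht := h.taylor (fun k => r * (u₀ k : ℝ)) fun k => r * (u k : ℝ)
      have ht' : |f (fun k => r * (u k : ℝ)) - f (fun k => r * (u₀ k : ℝ))
          - F (fun k => r * (u₀ k : ℝ)) i * s| ≤ L * s ^ 2 := by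
        rw [hsum] at ht
        refine ht.trans ?_
        rw [← sq_abs s]
        gcongr
      obtain ⟨-, g1, -⟩ := hU u huU
      obtain ⟨-, g2, g3⟩ := hU u₀ hu₀
      have hsξ : ∑ k, ξ k * (r * u k) - ∑ k, ξ k * (r * u₀ k) = ξ i * s := by
        rw [← hsum, ← Finset.sum_sub_distrib]
        exact Finset.sum_congr rfl fun k _ => by ring
      have hmain : |F (fun k => r * (u₀ k : ℝ)) i - ξ i| * |s| ≤
          2 * (C₃ * ν ^ 4 * r ^ 2) + L * s ^ 2 := by
        rw [← abs_mul, sub_mul, ← hsξ]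
        rw [abs_le] at ht' g1 g2 ⊢
        constructor <;> linarith
      have hsℓ : |s| ≤ r * ℓ := by
        rw [hs, abs_mul, abs_of_pos hr]
        gcongr
      have hLs : L * s ^ 2 ≤ ν ^ 3 * r / 2 * |s| := by
        have e : ν ^ 3 * r / 2 = L * (r * ℓ) := by rw [hℓ]; field_simp
        rw [e, ← sq_abs, pow_two, ← mul_assoc]
        gcongr
      have hfin : ν ^ 3 * r / 2 * |s| ≤ 2 * (C₃ * ν ^ 4 * r ^ 2) := by
        have := mul_le_mul_of_nonneg_right g3 (abs_nonneg s)
        linarith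
      rw [hs, abs_mul, abs_of_pos hr] at hfin
      refine le_of_mul_le_mul_left (a := ν ^ 3 * r ^ 2 / 2) ?_ (by positivity)
      calc _ = ν ^ 3 * r / 2 * (r * |(u i : ℝ) - u₀ i|) := by ring
        _ ≤ _ := hfin
        _ = _ := by ring
    calc ((U.filter fun u => φ u = φ u₀).card : ℝ) ≤ (intNear (u₀ i) (4 * C₃ * ν)).card := by
          refine Nat.cast_le.2 (Finset.card_le_card_of_injOn (fun u => u i) hin ?_)
          intro u hu u' hu' huu
          have hu1 := (Finset.mem_filter.1 hu).2
          have hu2 := (Finset.mem_filter.1 hu').2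
          funext k
          by_cases hk : k = i
          · subst hk; exact huu
          · rw [hout u hu1 k hk, hout u' hu2 k hk]
      _ ≤ 2 * (4 * C₃ * ν) + 1 := card_intNear_le (by positivity)
      _ ≤ _ := by linarith
  calc (U.card : ℝ) = ∑ w ∈ U.image φ, ((U.filter fun u => φ u = w).card : ℝ) := by
        rw [← Nat.cast_sum, ← Finset.card_eq_sum_card_image]
    _ ≤ ∑ _w ∈ U.image φ, (8 * C₃ + 1) * ν := Finset.sum_le_sum hfib
    _ = (U.image φ).card * ((8 * C₃ + 1) * ν) := by rw [Finset.sum_const, nsmul_eq_mul]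
    _ ≤ ((4 * L * C₁ + 3) * ν * ((2 * C₁ + 1) * ν ^ 4) ^ (d - 1)) * ((8 * C₃ + 1) * ν) := by gcongr
    _ = _ := by rw [mul_pow]; ring

theorem card_level_le {d : ℕ} (hd : 2 ≤ d) {L : ℝ} (hL : 1 ≤ L) {C₁ C₃ : ℝ} (hC₁ : 0 ≤ C₁)
    (hC₃ : 0 ≤ C₃) : ∃ C > (0 : ℝ), ∀ (f : (Fin d → ℝ) → ℝ) (F : (Fin d → ℝ) → Fin d → ℝ),
    IsGradientPair L f F → ∀ (ξ x : Fin d → ℝ) (r μ v : ℝ), F x = ξ → 0 < r → 1 ≤ μ →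
    ∀ U : Finset (Fin d → ℤ), (∀ u ∈ U, (∀ k, |r * u k - x k| ≤ C₁ * μ * r) ∧
      |f (fun k => r * u k) - ∑ k, ξ k * (r * u k) - v| ≤ C₃ * μ * r ^ 2) →
    (U.card : ℝ) ≤ C * (μ ^ (d - 1) * √μ) := by
  classical
  refine ⟨(2 * L + 1) ^ d + d * ((8 * C₃ + 1) * (4 * L * C₁ + 3) * (2 * C₁ + 1) ^ (d - 1)),
    by positivity, ?_⟩
  intro f F h ξ x r μ v hx hr hμ U hU
  set ν : ℝ := √(√μ) with hν
  have hν2 : ν ^ 2 = √μ := Real.sq_sqrt (Real.sqrt_nonneg _)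
  have hν4 : ν ^ 4 = μ := by
    rw [show ν ^ 4 = (ν ^ 2) ^ 2 by ring, hν2, Real.sq_sqrt (by linarith)]
  have hν1 : 1 ≤ ν := by
    rw [hν, Real.one_le_sqrt, Real.one_le_sqrt]
    exact hμ
  set c := (8 * C₃ + 1) * (4 * L * C₁ + 3) * (2 * C₁ + 1) ^ (d - 1)
  let U₀ := U.filter fun u => ∀ i, |F (fun k => r * u k) i - ξ i| < ν ^ 3 * r
  let W : Fin d → Finset (Fin d → ℤ) := fun i =>
    U.filter fun u => ν ^ 3 * r ≤ |F (fun k => r * u k) i - ξ i|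
  have hsub : U ⊆ U₀ ∪ Finset.univ.biUnion W := by
    intro u hu
    rw [Finset.mem_union, Finset.mem_biUnion]
    by_cases h0 : ∀ i, |F (fun k => r * u k) i - ξ i| < ν ^ 3 * r
    · exact Or.inl (Finset.mem_filter.2 ⟨hu, h0⟩)
    · push Not at h0
      obtain ⟨i, hi⟩ := h0
      exact Or.inr ⟨i, Finset.mem_univ i, Finset.mem_filter.2 ⟨hu, hi⟩⟩
  have h0 : (U₀.card : ℝ) ≤ (2 * L + 1) ^ d * (μ ^ (d - 1) * √μ) := by
    have h1 : (U₀.card : ℝ) ≤ (2 * (L * ν ^ 3) + 1) ^ d := by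
      refine card_le_of_forall_near (x := fun k => x k / r) (by positivity) fun u hu k => ?_
      have hlt := (Finset.mem_filter.1 hu).2
      have h2 : ‖F (fun k => r * u k) - F x‖ ≤ ν ^ 3 * r := by
        rw [pi_norm_le_iff_of_nonneg (by positivity), hx]
        exact fun i => (hlt i).le
      have h3 := (norm_le_pi_norm _ k).trans ((h.antilip x _).trans
        (mul_le_mul_of_nonneg_left h2 (by linarith)))
      rw [Pi.sub_apply, Real.norm_eq_abs] at h3
      have e : (u k : ℝ) - x k / r = (r * u k - x k) / r := by field_simp
      rw [e, abs_div, abs_of_pos hr, div_le_iff₀ hr]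
      linarith
    refine h1.trans ?_
    calc (2 * (L * ν ^ 3) + 1) ^ d ≤ ((2 * L + 1) * ν ^ 3) ^ d := by
          gcongr
          nlinarith [one_le_pow₀ hν1 (n := 3)]
      _ = (2 * L + 1) ^ d * ν ^ (3 * d) := by rw [mul_pow, pow_mul]
      _ ≤ (2 * L + 1) ^ d * ν ^ (4 * (d - 1) + 2) := by
          gcongr
          omega
      _ = _ := by rw [pow_add, pow_mul, hν4, hν2]
  have hW : ∀ i, ((W i).card : ℝ) ≤ c * (μ ^ (d - 1) * √μ) := by
    intro i
    have := card_level_partial_le hL hC₁ hC₃ h ξ x hr hν1 v i (W i) fun u hu => by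
      obtain ⟨hu, hu'⟩ := Finset.mem_filter.1 hu
      rw [hν4]
      exact ⟨(hU u hu).1, (hU u hu).2, hu'⟩
    rw [hν4, hν2] at this
    linarith
  calc (U.card : ℝ) ≤ U₀.card + ∑ i, ((W i).card : ℝ) := by
        exact_mod_cast (Finset.card_le_card hsub).trans ((Finset.card_union_le _ _).trans
          (Nat.add_le_add_left Finset.card_biUnion_le _))
    _ ≤ (2 * L + 1) ^ d * (μ ^ (d - 1) * √μ) + ∑ _i : Fin d, c * (μ ^ (d - 1) * √μ) :=
        add_le_add h0 (Finset.sum_le_sum fun i _ => hW i)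
    _ = _ := by
        rw [Finset.sum_const, Finset.card_univ, Fintype.card_fin, nsmul_eq_mul]
        ring

/-- `M` bounds the number of rational points `a / q` with `1 ≤ q ≤ Q`, at distance at most `1` from
`y`, such that `q f(a / q)` is at distance at most `δ` from an integer. -/
def CountBound {d : ℕ} (f : (Fin d → ℝ) → ℝ) (y : Fin d → ℝ) (Q : ℕ) (δ M : ℝ) : Prop :=
  ∀ S : Finset (ℤ × (Fin d → ℤ)), (∀ p ∈ S, 1 ≤ p.1 ∧ p.1 ≤ Q ∧
    (∀ i, |(p.2 i : ℝ) / p.1 - y i| ≤ 1) ∧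
    ∃ b : ℤ, |(p.1 : ℝ) * f (fun i => (p.2 i : ℝ) / p.1) - b| ≤ δ) → (S.card : ℝ) ≤ M

lemma exists_grid_dual {d : ℕ} {L : ℝ} {f : (Fin d → ℝ) → ℝ} {F : (Fin d → ℝ) → Fin d → ℝ}
    (hL : 1 ≤ L) (h : IsGradientPair L f F) (y : Fin d → ℝ) (Q H : ℕ) (hH : 1 ≤ H) {r : ℝ}
    (hr : 0 < r) (hr2 : r ^ 2 * (32 * L * H * Q) = 1) (hA : 1 ≤ Q * r)
    (S : Finset (ℤ × (Fin d → ℤ)))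
    (hS : ∀ p ∈ S, 1 ≤ p.1 ∧ p.1 ≤ Q ∧ (∀ i, |(p.2 i : ℝ) / p.1 - y i| ≤ 1) ∧
      ∃ b : ℤ, |(p.1 : ℝ) * f (fun i => (p.2 i : ℝ) / p.1) - b| ≤ 1 / (32 * H)) :
    ∃ (U : Finset (Fin d → ℤ)) (T : (Fin d → ℤ) → Finset (ℤ × (Fin d → ℤ) × ℤ)),
      (U.card : ℝ) ≤ (4 / r) ^ d ∧ (∀ u ∈ U, (∀ i, |r * u i - y i| ≤ 2) ∧
        ∀ t ∈ T u, 1 ≤ t.1 ∧ t.1 ≤ H ∧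
        (∀ i, |(t.2.1 i : ℝ) - t.1 * F (fun k => r * u k) i| ≤ 1 / (8 * (d + 1)) / (Q * r)) ∧
        |t.2.2 + ∑ i, t.2.1 i * (r * u i) - t.1 * f (fun k => r * u k)| ≤
          1 / (8 * (d + 1)) / Q) ∧
      (S.card : ℝ) * H ≤ 4 * (16 * (d + 1)) ^ (d + 1) * ((Q * r) ^ d * Q) *
        (U.card + 2 * ∑ u ∈ U, ((T u).card : ℝ)) := by
  classical
  have hHR : (1 : ℝ) ≤ H := by exact_mod_cast hH
  have hQ0 : 0 < Q := by
    rcases Nat.eq_zero_or_pos Q with h0 | h0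
    · rw [h0] at hA
      norm_num at hA
    · exact h0
  have hQR : (1 : ℝ) ≤ Q := by exact_mod_cast hQ0
  have hr1 : r ≤ 1 := by
    by_contra hlt
    push Not at hlt
    have h1 : 1 < r ^ 2 := one_lt_pow₀ hlt two_ne_zero
    have h2 : (1 : ℝ) ≤ 32 * L * H * Q := by
      calc (1 : ℝ) = 1 * 1 * 1 * 1 := by norm_num
        _ ≤ 32 * L * H * Q := by gcongr; norm_num
    nlinarith
  let φ : ℤ × (Fin d → ℤ) → Fin d → ℤ := fun p i => round ((p.2 i : ℝ) / p.1 / r)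
  have hφ : ∀ p i, |(p.2 i : ℝ) / p.1 - r * φ p i| ≤ r / 2 := by
    intro p i
    have h1 := abs_sub_round ((p.2 i : ℝ) / p.1 / r)
    have e : (p.2 i : ℝ) / p.1 - r * φ p i = r * ((p.2 i : ℝ) / p.1 / r - φ p i) := by
      field_simp
    rw [e, abs_mul, abs_of_pos hr]
    nlinarith
  have hfib : ∀ u, ∃ T : Finset (ℤ × (Fin d → ℤ) × ℤ), (∀ t ∈ T, 1 ≤ t.1 ∧ t.1 ≤ H ∧
        (∀ i, |(t.2.1 i : ℝ) - t.1 * F (fun k => r * u k) i| ≤ 1 / (8 * (d + 1)) / (Q * r)) ∧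
        |t.2.2 + ∑ i, t.2.1 i * (r * u i) - t.1 * f (fun k => r * u k)| ≤
          1 / (8 * (d + 1)) / Q) ∧
      ((S.filter fun p => φ p = u).card : ℝ) * H ≤
        4 * (16 * (d + 1)) ^ (d + 1) * ((Q * r) ^ d * Q) * (1 + 2 * T.card) := by
    intro u
    refine exists_pos_dual_finset (fun k => r * u k) (F fun k => r * u k) (f fun k => r * u k)
      Q (Q * r) hQR hA H hH _ fun p hp => ?_
    obtain ⟨hpS, hpu⟩ := Finset.mem_filter.1 hp
    obtain ⟨hq1, hqQ, -, b, hb⟩ := hS p hpS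
    have hq : (1 : ℝ) ≤ p.1 := by exact_mod_cast hq1
    have hqQ' : (p.1 : ℝ) ≤ Q := by exact_mod_cast hqQ
    have hnear : ∀ i, |(p.2 i : ℝ) / p.1 - r * u i| ≤ r / 2 := by
      intro i
      rw [← hpu]
      exact hφ p i
    refine ⟨by rwa [abs_of_nonneg (by linarith)], fun i => ?_, b, ?_⟩
    · have e : (p.2 i : ℝ) - p.1 * (r * u i) = p.1 * ((p.2 i : ℝ) / p.1 - r * u i) := by
        field_simp
      rw [e, abs_mul, abs_of_pos (by linarith)]
      have := hnear i
      calc (p.1 : ℝ) * _ ≤ Q * (r / 2) := by gcongr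
        _ ≤ Q * r := by gcongr; linarith
    · have ht := h.taylor (fun k => r * (u k : ℝ)) (fun i => (p.2 i : ℝ) / p.1)
      have hn : ‖(fun i => (p.2 i : ℝ) / p.1) - fun k => r * (u k : ℝ)‖ ≤ r / 2 := by
        rw [pi_norm_le_iff_of_nonneg (by positivity)]
        exact hnear
      have hn2 : L * ‖(fun i => (p.2 i : ℝ) / p.1) - fun k => r * (u k : ℝ)‖ ^ 2 ≤
          L * (r / 2) ^ 2 := by gcongr
      have e : (p.1 : ℝ) * f (fun k => r * u k)
          + ∑ i, F (fun k => r * u k) i * ((p.2 i : ℝ) - p.1 * (r * u i)) - b =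
          (p.1 * f (fun i => (p.2 i : ℝ) / p.1) - b) - p.1 * (f (fun i => (p.2 i : ℝ) / p.1)
            - f (fun k => r * u k) - ∑ i, F (fun k => r * u k) i * ((p.2 i : ℝ) / p.1 - r * u i)) := by
        have : ∑ i, F (fun k => r * u k) i * ((p.2 i : ℝ) - p.1 * (r * u i)) =
            p.1 * ∑ i, F (fun k => r * u k) i * ((p.2 i : ℝ) / p.1 - r * u i) := by
          rw [Finset.mul_sum]
          refine Finset.sum_congr rfl fun i _ => ?_
          field_simp
        rw [this]
        ring
      rw [e]
      refine (abs_sub _ _).trans ?_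
      rw [abs_mul, abs_of_pos (by linarith : (0 : ℝ) < p.1)]
      have h3 : (p.1 : ℝ) * |f (fun i => (p.2 i : ℝ) / p.1) - f (fun k => r * u k)
          - ∑ i, F (fun k => r * u k) i * ((p.2 i : ℝ) / p.1 - r * u i)| ≤ Q * (L * (r / 2) ^ 2) := by
        have := ht.trans hn2
        gcongr
      have e2 : 1 / (32 * (H : ℝ)) = Q * (L * r ^ 2) := by
        rw [div_eq_iff (by positivity)]
        linarith
      have e3 : 1 / (16 * (H : ℝ)) = 2 * (1 / (32 * (H : ℝ))) := by
        field_simp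
        norm_num
      rw [e3]
      have h4 : 0 ≤ Q * (L * r ^ 2) := by positivity
      rw [e2] at hb ⊢
      nlinarith
  choose T hT using hfib
  refine ⟨S.image φ, T, ?_, fun u hu => ⟨?_, (hT u).1⟩, ?_⟩
  · have hnear : ∀ u ∈ S.image φ, ∀ i, |(u i : ℝ) - y i / r| ≤ 3 / 2 / r := by
      intro u hu i
      obtain ⟨p, hp, rfl⟩ := Finset.mem_image.1 hu
      have h1 := hφ p i
      have h2 := (hS p hp).2.2.1 i
      have e : (φ p i : ℝ) - y i / r = (r * φ p i - y i) / r := by field_simp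
      rw [e, abs_div, abs_of_pos hr]
      gcongr
      rw [abs_le] at h1 h2 ⊢
      constructor <;> linarith
    refine (card_le_of_forall_near (by positivity) hnear).trans ?_
    gcongr
    rw [le_div_iff₀ hr, add_mul, mul_assoc, div_mul_cancel₀ _ hr.ne']
    linarith
  · obtain ⟨p, hp, rfl⟩ := Finset.mem_image.1 hu
    intro i
    have h1 := hφ p i
    have h2 := (hS p hp).2.2.1 i
    rw [abs_le] at h1 h2 ⊢
    constructor <;> linarith
  · have e : (S.card : ℝ) * H = ∑ u ∈ S.image φ, ((S.filter fun p => φ p = u).card : ℝ) * H := by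
      rw [← Finset.sum_mul, ← Nat.cast_sum, ← Finset.card_eq_sum_card_image]
    rw [e]
    refine (Finset.sum_le_sum fun u _ => (hT u).2).trans (le_of_eq ?_)
    rw [← Finset.mul_sum, Finset.sum_add_distrib, ← Finset.mul_sum]
    simp

lemma card_le_of_countBound {d : ℕ} {g : (Fin d → ℝ) → ℝ} {X : ℕ} {δ M R : ℝ} (hR : 0 ≤ R)
    (hδ : δ < 1 / 2) (hM : 0 ≤ M) (hg : ∀ y, CountBound g y X δ M) (z : Fin d → ℝ)
    (T : Finset (ℤ × (Fin d → ℤ) × ℤ)) (hT : ∀ t ∈ T, 1 ≤ t.1 ∧ t.1 ≤ X ∧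
      (∀ i, |(t.2.1 i : ℝ) / t.1 - z i| ≤ R) ∧
      |(t.2.2 : ℝ) + t.1 * g (fun i => (t.2.1 i : ℝ) / t.1)| ≤ δ) :
    (T.card : ℝ) ≤ (2 * R + 2) ^ d * M := by
  classical
  let φ : ℤ × (Fin d → ℤ) × ℤ → Fin d → ℤ := fun t i => round ((t.2.1 i : ℝ) / t.1 - z i)
  have himg : ((T.image φ).card : ℝ) ≤ (2 * R + 2) ^ d := by
    have hnear : ∀ u ∈ T.image φ, ∀ i, |(u i : ℝ) - (0 : Fin d → ℝ) i| ≤ R + 1 / 2 := by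
      intro u hu i
      obtain ⟨t, ht, rfl⟩ := Finset.mem_image.1 hu
      have h1 := (hT t ht).2.2.1 i
      have h2 := abs_sub_round ((t.2.1 i : ℝ) / t.1 - z i)
      simp only [Pi.zero_apply, φ]
      rw [abs_le] at h1 h2 ⊢
      constructor <;> linarith
    refine (card_le_of_forall_near (by positivity) hnear).trans (le_of_eq ?_)
    ring
  have hfib : ∀ u ∈ T.image φ, ((T.filter fun t => φ t = u).card : ℝ) ≤ M := by
    intro u _
    have hinj : Set.InjOn (fun t : ℤ × (Fin d → ℤ) × ℤ => (t.1, t.2.1))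
        (T.filter fun t => φ t = u) := by
      rintro ⟨j, k, m⟩ ht ⟨j', k', m'⟩ ht' he
      obtain ⟨rfl, rfl⟩ := Prod.ext_iff.1 he
      have h1 := (hT _ (Finset.mem_filter.1 ht).1).2.2.2
      have h2 := (hT _ (Finset.mem_filter.1 ht').1).2.2.2
      have h3 : m - m' = 0 := by
        refine int_eq_zero_of_abs_lt ?_
        push_cast
        dsimp only at h1 h2
        rw [abs_le] at h1 h2
        rw [abs_lt]
        constructor <;> linarith
      rw [sub_eq_zero.1 h3]
    rw [← Finset.card_image_of_injOn hinj]
    refine hg (fun i => z i + u i) _ fun p hp => ?_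
    obtain ⟨t, ht, rfl⟩ := Finset.mem_image.1 hp
    obtain ⟨htT, htu⟩ := Finset.mem_filter.1 ht
    obtain ⟨h1, h2, -, h4⟩ := hT t htT
    refine ⟨h1, h2, fun i => ?_, -t.2.2, ?_⟩
    · have h5 := abs_sub_round ((t.2.1 i : ℝ) / t.1 - z i)
      have h6 : round ((t.2.1 i : ℝ) / t.1 - z i) = u i := congrFun htu i
      rw [h6] at h5
      dsimp only
      rw [abs_le] at h5 ⊢
      constructor <;> linarith
    · push_cast
      rw [sub_neg_eq_add, add_comm]
      exact h4
  calc (T.card : ℝ) = ∑ u ∈ T.image φ, ((T.filter fun t => φ t = u).card : ℝ) := by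
        rw [← Nat.cast_sum, ← Finset.card_eq_sum_card_image]
    _ ≤ ∑ _u ∈ T.image φ, M := Finset.sum_le_sum hfib
    _ = (T.image φ).card * M := by rw [Finset.sum_const, nsmul_eq_mul]
    _ ≤ _ := by gcongr

lemma sum_div_pow_le {d : ℕ} {g : (Fin d → ℝ) → ℝ} {H Q : ℕ} {A₀ E C₂ R : ℝ} (hd : 1 ≤ d)
    (hQ : 1 ≤ Q) (hA₀ : 0 ≤ A₀) (hE : 0 ≤ E) (hR : 0 ≤ R) (hC₂ : 1 ≤ C₂) (hHQ : 4 * C₂ * H < Q)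
    (hg : ∀ y, ∀ X : ℕ, 1 ≤ X → X ≤ H → ∀ δ : ℝ, 0 < δ →
      CountBound g y X δ (A₀ * δ * X ^ (d + 1) + E * X ^ d))
    (z : Fin d → ℝ) (T : Finset (ℤ × (Fin d → ℤ) × ℤ)) (hT : ∀ t ∈ T, 1 ≤ t.1 ∧ t.1 ≤ H ∧
      (∀ i, |(t.2.1 i : ℝ) / t.1 - z i| ≤ R) ∧
      |(t.2.2 : ℝ) + t.1 * g (fun i => (t.2.1 i : ℝ) / t.1)| ≤ C₂ * (H / t.1) / Q) :
    ∑ t ∈ T, ((H : ℝ) / t.1) ^ (d - 1) * √((H : ℝ) / t.1) ≤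
      2 ^ (d + 4) * C₂ * (2 * R + 2) ^ d * ((A₀ * (H / Q) + E) * H ^ d) := by
  classical
  have hQR : (1 : ℝ) ≤ Q := by exact_mod_cast hQ
  have hs : ∀ t, ∃ s : ℕ, t ∈ T → (2 : ℝ) ^ s ≤ H / t.1 ∧ (H : ℝ) / t.1 < 2 ^ (s + 1) := by
    intro t
    by_cases ht : t ∈ T
    · obtain ⟨h1, h2, -⟩ := hT t ht
      have h1' : (1 : ℝ) ≤ t.1 := by exact_mod_cast h1
      have h2' : (t.1 : ℝ) ≤ H := by exact_mod_cast h2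
      obtain ⟨s, hs⟩ := exists_nat_pow_near (x := (H : ℝ) / t.1) (y := 2)
        ((one_le_div (by linarith)).2 h2') one_lt_two
      exact ⟨s, fun _ => hs⟩
    · exact ⟨0, fun h => absurd h ht⟩
  choose s hs using hs
  set B : ℝ := (A₀ * (H / Q) + E) * H ^ d with hB
  have hB0 : 0 ≤ B := by positivity
  have hcard : ∀ k ∈ T.image s, ((T.filter fun t => s t = k).card : ℝ) ≤
      (2 * R + 2) ^ d * (2 * C₂ * B / (2 ^ k) ^ d) := by
    intro k hk
    obtain ⟨t₀, ht₀, rfl⟩ := Finset.mem_image.1 hk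
    have hb : ∀ t ∈ T, (2 : ℝ) ^ s t * t.1 ≤ H := fun t ht => by
      have h1' : (1 : ℝ) ≤ t.1 := by exact_mod_cast (hT t ht).1
      rw [← le_div_iff₀ (by linarith)]
      exact (hs t ht).1
    have h2H : (2 : ℝ) ^ s t₀ ≤ H := by
      have h1' : (1 : ℝ) ≤ t₀.1 := by exact_mod_cast (hT t₀ ht₀).1
      exact (le_mul_of_one_le_right (by positivity) h1').trans (hb t₀ ht₀)
    set X : ℕ := H / 2 ^ s t₀ with hX
    have hX1 : 1 ≤ X := by
      rw [hX, Nat.one_le_div_iff (by positivity)]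
      exact_mod_cast h2H
    have hXH : X ≤ H := Nat.div_le_self _ _
    have hXR : (X : ℝ) ≤ H / 2 ^ s t₀ := by
      refine Nat.cast_div_le.trans (le_of_eq ?_)
      push_cast
      rfl
    set δ : ℝ := C₂ * 2 ^ (s t₀ + 1) / Q with hδ
    have hδ0 : 0 < δ := by positivity
    have hδ1 : δ < 1 / 2 := by
      rw [hδ, div_lt_iff₀ (by linarith), pow_succ]
      nlinarith
    refine (card_le_of_countBound hR hδ1 (by positivity) (fun y => hg y X hX1 hXH δ hδ0) z _
      fun t ht => ?_).trans ?_
    · obtain ⟨ht, hst⟩ := Finset.mem_filter.1 ht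
      obtain ⟨h1, h2, h3, h4⟩ := hT t ht
      refine ⟨h1, ?_, h3, h4.trans ?_⟩
      · have h5 := hb t ht
        rw [hst] at h5
        have h6 : (2 : ℤ) ^ s t₀ * t.1 ≤ H := by exact_mod_cast h5
        rw [hX]
        push_cast
        rw [Int.le_ediv_iff_mul_le (by positivity)]
        linarith
      · rw [hδ, ← hst]
        gcongr
        exact (hs t ht).2.le
    · refine mul_le_mul_of_nonneg_left ?_ (by positivity)
      have e1 : A₀ * δ * X ^ (d + 1) ≤ A₀ * δ * (H / 2 ^ s t₀) ^ (d + 1) := by gcongr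
      have e2 : E * X ^ d ≤ E * (H / 2 ^ s t₀) ^ d := by gcongr
      have e3 : A₀ * δ * (H / 2 ^ s t₀) ^ (d + 1) =
          2 * C₂ * (A₀ * (H / Q) * H ^ d) / (2 ^ s t₀) ^ d := by
        rw [hδ, div_pow, pow_succ (H : ℝ), pow_succ ((2 : ℝ) ^ s t₀), pow_succ (2 : ℝ)]
        field_simp
      have e4 : E * (H / 2 ^ s t₀) ^ d ≤ 2 * C₂ * (E * H ^ d) / (2 ^ s t₀) ^ d := by
        rw [div_pow, mul_div_assoc']
        refine div_le_div_of_nonneg_right ?_ (by positivity)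
        exact le_mul_of_one_le_left (by positivity) (by linarith)
      calc _ ≤ 2 * C₂ * (A₀ * (H / Q) * H ^ d) / (2 ^ s t₀) ^ d
            + 2 * C₂ * (E * H ^ d) / (2 ^ s t₀) ^ d := by linarith
        _ = _ := by rw [hB]; ring
  have hterm : ∀ k ∈ T.image s, ∑ t ∈ T with s t = k,
      ((H : ℝ) / t.1) ^ (d - 1) * √((H : ℝ) / t.1) ≤
      (2 ^ (d + 2) * C₂ * (2 * R + 2) ^ d * B) * (3 / 4) ^ k := by
    intro k hk
    have h1 : ∀ t ∈ T.filter fun t => s t = k, ((H : ℝ) / t.1) ^ (d - 1) * √((H : ℝ) / t.1) ≤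
        2 ^ (d + 1) * ((2 ^ k) ^ (d - 1) * (3 / 2) ^ k) := by
      intro t ht
      obtain ⟨htT, rfl⟩ := Finset.mem_filter.1 ht
      have ht1 : (1 : ℝ) ≤ t.1 := by exact_mod_cast (hT t htT).1
      have h2 := (hs t htT).2.le
      have h3 : √((H : ℝ) / t.1) ≤ 4 * (3 / 2) ^ s t := by
        rw [Real.sqrt_le_left (by positivity)]
        refine h2.trans ?_
        rw [mul_pow, ← pow_mul, mul_comm (s t) 2, pow_mul, pow_succ]
        have : (2 : ℝ) ^ s t ≤ ((3 / 2) ^ 2) ^ s t := by gcongr; norm_num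
        nlinarith [pow_pos (two_pos : (0 : ℝ) < 2) (s t)]
      calc _ ≤ ((2 : ℝ) ^ (s t + 1)) ^ (d - 1) * (4 * (3 / 2) ^ s t) := by gcongr
        _ = 2 ^ (d + 1) * ((2 ^ s t) ^ (d - 1) * (3 / 2) ^ s t) := by
          obtain ⟨e, rfl⟩ := Nat.exists_eq_add_of_le' hd
          rw [Nat.add_sub_cancel, pow_succ (2 : ℝ) (s t), mul_pow]
          ring
    refine (Finset.sum_le_card_nsmul _ _ _ h1).trans ?_
    rw [nsmul_eq_mul]
    calc _ ≤ ((2 * R + 2) ^ d * (2 * C₂ * B / (2 ^ k) ^ d)) *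
          (2 ^ (d + 1) * ((2 ^ k) ^ (d - 1) * (3 / 2) ^ k)) :=
          mul_le_mul_of_nonneg_right (hcard k hk) (by positivity)
      _ = _ := by
          obtain ⟨e, rfl⟩ := Nat.exists_eq_add_of_le' hd
          rw [Nat.add_sub_cancel, pow_succ ((2 : ℝ) ^ k) e,
            show (3 / 4 : ℝ) ^ k = (3 / 2) ^ k / 2 ^ k by rw [← div_pow]; norm_num]
          field_simp
          ring
  calc _ = ∑ k ∈ T.image s, ∑ t ∈ T with s t = k,
        ((H : ℝ) / t.1) ^ (d - 1) * √((H : ℝ) / t.1) :=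
        (Finset.sum_fiberwise_of_maps_to (fun t ht => Finset.mem_image_of_mem s ht) _).symm
    _ ≤ ∑ k ∈ T.image s, (2 ^ (d + 2) * C₂ * (2 * R + 2) ^ d * B) * (3 / 4) ^ k :=
        Finset.sum_le_sum hterm
    _ = (2 ^ (d + 2) * C₂ * (2 * R + 2) ^ d * B) * ∑ k ∈ T.image s, (3 / 4 : ℝ) ^ k := by
        rw [Finset.mul_sum]
    _ ≤ (2 ^ (d + 2) * C₂ * (2 * R + 2) ^ d * B) * 4 := by
        gcongr
        refine ((summable_geometric_of_lt_one (by norm_num) (by norm_num)).sum_le_tsum _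
          fun k _ => by positivity).trans (le_of_eq ?_)
        rw [tsum_geometric_of_lt_one (by norm_num) (by norm_num)]
        norm_num
    _ = _ := by ring

/-- A dual frequency `t` attached to `x₀` is a rational point close to the dual hypersurface, and
`x₀` lies close to its critical point. -/
lemma dual_frequency_near {d : ℕ} {L : ℝ} {f g : (Fin d → ℝ) → ℝ} {F G : (Fin d → ℝ) → Fin d → ℝ}
    (hL : 1 ≤ L) (h : IsGradientPair L f F) (hFG : ∀ ξ, F (G ξ) = ξ)
    (hg : ∀ ξ, g ξ = ∑ i, ξ i * G ξ i - f (G ξ)) (y x₀ : Fin d → ℝ) {Q H : ℕ} (hH : 1 ≤ H) {r : ℝ}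
    (hr : 0 < r) (hr2 : r ^ 2 * (32 * L * H * Q) = 1) (hA : 1 ≤ Q * r)
    (hy : ∀ i, |x₀ i - y i| ≤ 2) (t : ℤ × (Fin d → ℤ) × ℤ) (h1 : 1 ≤ t.1) (h2 : t.1 ≤ H)
    (h3 : ∀ i, |(t.2.1 i : ℝ) - t.1 * F x₀ i| ≤ 1 / (8 * (d + 1)) / (Q * r))
    (h4 : |t.2.2 + ∑ i, t.2.1 i * x₀ i - t.1 * f x₀| ≤ 1 / (8 * (d + 1)) / Q) :
    (∀ k, |x₀ k - G (fun i => (t.2.1 i : ℝ) / t.1) k| ≤ 4 * L ^ 2 * (H / t.1) * r) ∧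
    |f x₀ - ∑ k, (t.2.1 k : ℝ) / t.1 * x₀ k - t.2.2 / t.1| ≤ 4 * L * (H / t.1) * r ^ 2 ∧
    (∀ i, |(t.2.1 i : ℝ) / t.1 - F y i| ≤ 1 + 2 * L) ∧
    |(t.2.2 : ℝ) + t.1 * g (fun i => (t.2.1 i : ℝ) / t.1)| ≤
      (1 + 16 * L ^ 4) * (H / t.1) / Q := by
  have hHR : (1 : ℝ) ≤ H := by exact_mod_cast hH
  have hQ0 : 0 < Q := by
    rcases Nat.eq_zero_or_pos Q with h0 | h0
    · rw [h0] at hA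
      norm_num at hA
    · exact h0
  have hQR : (1 : ℝ) ≤ Q := by exact_mod_cast hQ0
  have ht1 : (1 : ℝ) ≤ t.1 := by exact_mod_cast h1
  have htH : (t.1 : ℝ) ≤ H := by exact_mod_cast h2
  have ht0 : (0 : ℝ) < t.1 := by linarith
  have hc : 1 / (8 * ((d : ℝ) + 1)) ≤ 1 / 8 := by
    gcongr
    have : (0 : ℝ) ≤ d := Nat.cast_nonneg d
    linarith
  have hAinv : 1 / (Q * r) = 32 * L * H * r := by
    rw [div_eq_iff (by positivity)]
    linarith
  have hQinv : 1 / (Q : ℝ) = 32 * L * H * r ^ 2 := by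
    rw [div_eq_iff (by positivity)]
    linarith
  have h3' : ∀ i, |(t.2.1 i : ℝ) - t.1 * F x₀ i| ≤ 4 * L * H * r := by
    intro i
    refine (h3 i).trans ?_
    rw [div_eq_mul_one_div _ (Q * r), hAinv]
    calc _ ≤ 1 / 8 * (32 * L * H * r) := by gcongr
      _ = _ := by ring
  have h3'' : ∀ i, |(t.2.1 i : ℝ) - t.1 * F x₀ i| ≤ 1 := by
    intro i
    refine (h3 i).trans ?_
    rw [div_le_one (by linarith)]
    linarith
  have h4' : |t.2.2 + ∑ i, t.2.1 i * x₀ i - t.1 * f x₀| ≤ 1 / 8 * (1 / Q) := by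
    refine h4.trans ?_
    rw [div_eq_mul_one_div _ (Q : ℝ)]
    gcongr
  set ξ : Fin d → ℝ := fun i => (t.2.1 i : ℝ) / t.1 with hξ
  have hFξ : ‖F x₀ - ξ‖ ≤ 4 * L * (H / t.1) * r := by
    rw [pi_norm_le_iff_of_nonneg (by positivity)]
    intro i
    have e : (F x₀ - ξ) i = -(((t.2.1 i : ℝ) - t.1 * F x₀ i) / t.1) := by
      simp only [Pi.sub_apply, hξ]
      field_simp
      ring
    rw [e, norm_neg, Real.norm_eq_abs, abs_div, abs_of_pos ht0, div_le_iff₀ ht0]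
    refine (h3' i).trans (le_of_eq ?_)
    field_simp
  have hx : ‖x₀ - G ξ‖ ≤ 4 * L ^ 2 * (H / t.1) * r := by
    refine (h.antilip (G ξ) x₀).trans ?_
    rw [hFG]
    calc _ ≤ L * (4 * L * (H / t.1) * r) := by gcongr
      _ = _ := by ring
  refine ⟨fun k => (norm_le_pi_norm _ k).trans hx, ?_, fun i => ?_, ?_⟩
  · have e : f x₀ - ∑ k, ξ k * x₀ k - t.2.2 / t.1 =
        -((t.2.2 + ∑ i, t.2.1 i * x₀ i - t.1 * f x₀) / t.1) := by
      have : ∑ k, ξ k * x₀ k = (∑ i, t.2.1 i * x₀ i) / t.1 := by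
        rw [Finset.sum_div]
        exact Finset.sum_congr rfl fun k _ => by simp only [hξ]; ring
      rw [this]
      field_simp
      ring
    rw [e, abs_neg, abs_div, abs_of_pos ht0, div_le_iff₀ ht0]
    rw [hQinv] at h4'
    refine h4'.trans (le_of_eq ?_)
    field_simp
    ring
  · have e : ξ i - F y i = ((t.2.1 i : ℝ) - t.1 * F x₀ i) / t.1 + (F x₀ i - F y i) := by
      simp only [hξ]
      field_simp
      ring
    rw [e]
    refine (abs_add_le _ _).trans (add_le_add ?_ ?_)
    · rw [abs_div, abs_of_pos ht0, div_le_one ht0]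
      exact (h3'' i).trans ht1
    · refine (norm_le_pi_norm (F x₀ - F y) i).trans ((h.lip y x₀).trans ?_)
      rw [mul_comm 2 L]
      gcongr
      rw [pi_norm_le_iff_of_nonneg (by norm_num)]
      exact hy
  · have e : (t.2.2 : ℝ) + t.1 * g ξ = (t.2.2 + ∑ i, t.2.1 i * x₀ i - t.1 * f x₀)
        + t.1 * (f x₀ - f (G ξ) - ∑ i, F (G ξ) i * (x₀ i - G ξ i)) := by
      have e1 : ∑ i, F (G ξ) i * (x₀ i - G ξ i) = (∑ i, t.2.1 i * x₀ i) / t.1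
          - ∑ i, ξ i * G ξ i := by
        rw [hFG, Finset.sum_div, ← Finset.sum_sub_distrib]
        exact Finset.sum_congr rfl fun k _ => by simp only [hξ]; ring
      rw [e1, hg]
      field_simp
      ring
    rw [e]
    refine (abs_add_le _ _).trans ?_
    rw [abs_mul, abs_of_pos ht0]
    have ht := h.taylor (G ξ) x₀
    have h5 : (t.1 : ℝ) * |f x₀ - f (G ξ) - ∑ i, F (G ξ) i * (x₀ i - G ξ i)| ≤
        t.1 * (L * (4 * L ^ 2 * (H / t.1) * r) ^ 2) := by
      refine mul_le_mul_of_nonneg_left (ht.trans ?_) ht0.le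
      gcongr
    have h6 : t.1 * (L * (4 * L ^ 2 * (H / t.1) * r) ^ 2) = L ^ 4 / 2 * (H / t.1) * (1 / Q) := by
      rw [hQinv]
      field_simp
      ring
    have h7 : 1 ≤ (H : ℝ) / t.1 := (one_le_div ht0).2 htH
    have h8 : 1 / 8 * (1 / (Q : ℝ)) ≤ (H / t.1) * (1 / Q) :=
      mul_le_mul_of_nonneg_right (by linarith) (by positivity)
    have h9 : L ^ 4 / 2 * (H / t.1) * (1 / Q) ≤ 16 * L ^ 4 * (H / t.1) * (1 / (Q : ℝ)) := by
      gcongr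
      have : 0 ≤ L ^ 4 := by positivity
      linarith
    rw [h6] at h5
    calc _ ≤ 1 / 8 * (1 / (Q : ℝ)) + L ^ 4 / 2 * (H / t.1) * (1 / Q) := add_le_add h4' h5
      _ ≤ (H / t.1) * (1 / Q) + 16 * L ^ 4 * (H / t.1) * (1 / (Q : ℝ)) := add_le_add h8 h9
      _ = _ := by ring

theorem countBound_of_dual {d : ℕ} (hd : 2 ≤ d) {L : ℝ} (hL : 1 ≤ L) :
    ∃ C K : ℝ, 1 ≤ C ∧ 2 ≤ K ∧ ∀ Q H : ℕ, 1 ≤ H → K * H ≤ Q → ∀ A₀ E : ℝ, 0 ≤ A₀ → 0 ≤ E →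
      (∀ g G, IsGradientPair L g G → ∀ y : Fin d → ℝ, ∀ X : ℕ, 1 ≤ X → X ≤ H → ∀ δ : ℝ, 0 < δ →
        CountBound g y X δ (A₀ * δ * X ^ (d + 1) + E * X ^ d)) →
      ∀ f F, IsGradientPair L f F → ∀ y : Fin d → ℝ, CountBound f y Q (1 / (32 * H))
        (C * (Q ^ (d + 1) / H + (A₀ * (H / Q) + E) * Q ^ d / √((Q : ℝ) / H) ^ (d - 2))) := by
  classical
  have hL0 : 0 < L := by linarith
  obtain ⟨C₄, hC₄, hlev⟩ := card_level_le hd hL (C₁ := 4 * L ^ 2) (C₃ := 4 * L) (by positivity)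
    (by positivity)
  set C₂ : ℝ := 1 + 16 * L ^ 4 with hC₂
  have hC₂1 : 1 ≤ C₂ := by
    rw [hC₂]
    have : 0 ≤ L ^ 4 := by positivity
    linarith
  set c₀ : ℝ := 4 * (16 * ((d : ℝ) + 1)) ^ (d + 1) with hc₀
  have hc₀0 : 0 < c₀ := by positivity
  set c₁ : ℝ := 2 ^ (d + 4) * C₂ * (2 * (1 + 2 * L) + 2) ^ d with hc₁
  have hc₁0 : 0 < c₁ := by positivity
  refine ⟨1 + c₀ * 4 ^ d + c₀ * (2 * (C₄ * c₁)), 32 * L + 5 * C₂, ?_, by linarith, ?_⟩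
  · have h1 : 0 ≤ c₀ * 4 ^ d := by positivity
    have h2 : 0 ≤ c₀ * (2 * (C₄ * c₁)) := by positivity
    linarith
  intro Q H hH hKH A₀ E hA₀ hE hyp f F hfF y S hS
  have hHR : (1 : ℝ) ≤ H := by exact_mod_cast hH
  have hH0 : (0 : ℝ) < H := by linarith
  have hQ32 : 32 * L * H ≤ Q := by nlinarith
  have hQC : 4 * C₂ * H < Q := by nlinarith
  have hQ0 : (0 : ℝ) < Q := by nlinarith
  have hQ1 : 1 ≤ Q := by exact_mod_cast hQ0
  set s : ℝ := √((Q : ℝ) / H) with hs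
  have hs2 : s ^ 2 = Q / H := Real.sq_sqrt (by positivity)
  have hs0 : 0 < s := Real.sqrt_pos.2 (by positivity)
  have hl0 : 0 < √(32 * L) := Real.sqrt_pos.2 (by positivity)
  have hl2 : √(32 * L) ^ 2 = 32 * L := Real.sq_sqrt (by positivity)
  set r : ℝ := s / (Q * √(32 * L)) with hr
  have hr0 : 0 < r := by positivity
  have hr2 : r ^ 2 * (32 * L * H * Q) = 1 := by
    rw [hr, div_pow, mul_pow, hs2, hl2]
    field_simp
  have hAeq : Q * r = s / √(32 * L) := by
    rw [hr]
    field_simp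
  have hA : 1 ≤ Q * r := by
    rw [hAeq, one_le_div hl0, hs]
    refine Real.sqrt_le_sqrt ?_
    rwa [le_div_iff₀ hH0]
  have hAs : Q * r ≤ s := by
    rw [hAeq]
    refine div_le_self hs0.le ?_
    rw [Real.one_le_sqrt]
    linarith
  obtain ⟨U, T, hU, hUT, hcard⟩ := exists_grid_dual hL hfF y Q H hH hr0 hr2 hA S hS
  obtain ⟨g, G, hgG, hFG, hg⟩ := hfF.exists_legendre
  have hnear := fun u hu t ht => dual_frequency_near hL hfF hFG hg y (fun k => r * (u k : ℝ)) hH hr0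
    hr2 hA (hUT u hu).1 t ((hUT u hu).2 t ht).1 ((hUT u hu).2 t ht).2.1 ((hUT u hu).2 t ht).2.2.1
    ((hUT u hu).2 t ht).2.2.2
  have hsum : ∑ u ∈ U, ((T u).card : ℝ) ≤ C₄ * (c₁ * ((A₀ * (H / Q) + E) * H ^ d)) := by
    have e1 : ∑ u ∈ U, ((T u).card : ℝ) =
        ∑ t ∈ U.biUnion T, ((U.filter fun u => t ∈ T u).card : ℝ) := by
      have h1 : ∀ u ∈ U, T u = (U.biUnion T).filter fun t => t ∈ T u := by
        intro u hu
        ext t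
        simp only [Finset.mem_filter, Finset.mem_biUnion]
        exact ⟨fun ht => ⟨⟨u, hu, ht⟩, ht⟩, fun ht => ht.2⟩
      have h2 := Finset.sum_card_bipartiteAbove_eq_sum_card_bipartiteBelow
        (s := U) (t := U.biUnion T) fun u t => t ∈ T u
      simp only [Finset.bipartiteAbove, Finset.bipartiteBelow] at h2
      rw [← Nat.cast_sum, ← Nat.cast_sum, ← h2]
      exact congrArg _ (Finset.sum_congr rfl fun u hu => congrArg _ (h1 u hu))
    rw [e1]
    have h1 : ∀ t ∈ U.biUnion T, ((U.filter fun u => t ∈ T u).card : ℝ) ≤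
        C₄ * (((H : ℝ) / t.1) ^ (d - 1) * √((H : ℝ) / t.1)) := by
      intro t ht
      obtain ⟨u₀, hu₀, ht₀⟩ := Finset.mem_biUnion.1 ht
      obtain ⟨h1, h2, -⟩ := (hUT u₀ hu₀).2 t ht₀
      have ht1 : (1 : ℝ) ≤ t.1 := by exact_mod_cast h1
      have htH : (t.1 : ℝ) ≤ H := by exact_mod_cast h2
      refine hlev f F hfF (fun i => (t.2.1 i : ℝ) / t.1) (G fun i => (t.2.1 i : ℝ) / t.1) r _
        ((t.2.2 : ℝ) / t.1) (hFG _) hr0 ((one_le_div (by linarith)).2 htH) _ fun u hu => ?_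
      obtain ⟨huU, hut⟩ := Finset.mem_filter.1 hu
      obtain ⟨g1, g2, -⟩ := hnear u huU t hut
      exact ⟨g1, g2⟩
    refine (Finset.sum_le_sum h1).trans ?_
    rw [← Finset.mul_sum]
    refine mul_le_mul_of_nonneg_left ?_ hC₄.le
    refine sum_div_pow_le (by omega) hQ1 hA₀ hE (by positivity) hC₂1 hQC (hyp g G hgG) (F y) _
      fun t ht => ?_
    obtain ⟨u, hu, htu⟩ := Finset.mem_biUnion.1 ht
    obtain ⟨-, -, g3, g4⟩ := hnear u hu t htu
    exact ⟨((hUT u hu).2 t htu).1, ((hUT u hu).2 t htu).2.1, g3, g4⟩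
  set B : ℝ := A₀ * (H / Q) + E with hB
  have hB0 : 0 ≤ B := by positivity
  have hfirst : (Q * r) ^ d * Q * U.card ≤ 4 ^ d * (Q ^ (d + 1) / H) * H := by
    calc (Q * r) ^ d * Q * U.card ≤ (Q * r) ^ d * Q * (4 / r) ^ d := by gcongr
      _ = ((Q * r) * (4 / r)) ^ d * Q := by rw [mul_pow]; ring
      _ = (4 * Q) ^ d * Q := by
        congr 2
        rw [mul_assoc, mul_div_cancel₀ _ hr0.ne', mul_comm]
      _ = _ := by
        rw [mul_pow, pow_succ (Q : ℝ) d]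
        field_simp
  have hsecond : (Q * r) ^ d * Q * (B * H ^ d) ≤ (B * Q ^ d / s ^ (d - 2)) * H := by
    calc (Q * r) ^ d * Q * (B * H ^ d) ≤ s ^ d * Q * (B * H ^ d) := by gcongr
      _ = _ := by
        obtain ⟨e, rfl⟩ := Nat.exists_eq_add_of_le' hd
        have hQs : (Q : ℝ) = s ^ 2 * H := by rw [hs2]; field_simp
        rw [Nat.add_sub_cancel, hQs]
        field_simp
        ring
  refine le_of_mul_le_mul_right (hcard.trans ?_) hH0
  calc _ ≤ c₀ * ((Q * r) ^ d * Q) * (U.card + 2 * (C₄ * (c₁ * (B * H ^ d)))) := by gcongr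
    _ = c₀ * ((Q * r) ^ d * Q * U.card) + c₀ * (2 * (C₄ * c₁)) * ((Q * r) ^ d * Q * (B * H ^ d)) := by
      ring
    _ ≤ c₀ * (4 ^ d * (Q ^ (d + 1) / H) * H)
        + c₀ * (2 * (C₄ * c₁)) * ((B * Q ^ d / s ^ (d - 2)) * H) := by gcongr
    _ = (c₀ * 4 ^ d * (Q ^ (d + 1) / H) + c₀ * (2 * (C₄ * c₁)) * (B * Q ^ d / s ^ (d - 2))) * H := by
      ring
    _ ≤ ((1 + c₀ * 4 ^ d + c₀ * (2 * (C₄ * c₁))) * (Q ^ (d + 1) / H)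
        + (1 + c₀ * 4 ^ d + c₀ * (2 * (C₄ * c₁))) * (B * Q ^ d / s ^ (d - 2))) * H := by
      gcongr
      · have : 0 ≤ c₀ * (2 * (C₄ * c₁)) := by positivity
        linarith
      · have : 0 ≤ c₀ * 4 ^ d := by positivity
        linarith
    _ = _ := by ring

lemma countBound_trivial {d : ℕ} (f : (Fin d → ℝ) → ℝ) (y : Fin d → ℝ) {Q : ℕ} (hQ : 1 ≤ Q)
    (δ : ℝ) : CountBound f y Q δ (3 ^ d * Q ^ (d + 1)) := by
  classical
  intro S hS
  have hQR : (1 : ℝ) ≤ Q := by exact_mod_cast hQ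
  have hmaps : ∀ p ∈ S, p.1 ∈ Finset.Icc (1 : ℤ) Q := fun p hp =>
    Finset.mem_Icc.2 ⟨(hS p hp).1, (hS p hp).2.1⟩
  have hfib : ∀ q ∈ Finset.Icc (1 : ℤ) Q, ((S.filter fun p => p.1 = q).card : ℝ) ≤
      (3 * (Q : ℝ)) ^ d := by
    intro q hq
    have hinj : Set.InjOn (fun p : ℤ × (Fin d → ℤ) => p.2) (S.filter fun p => p.1 = q) := by
      intro p hp p' hp' he
      have h1 := (Finset.mem_filter.1 hp).2
      have h2 := (Finset.mem_filter.1 hp').2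
      exact Prod.ext (h1.trans h2.symm) he
    rw [← Finset.card_image_of_injOn hinj]
    refine (card_le_of_forall_near (x := fun i => q * y i) (e := Q) (by positivity) ?_).trans ?_
    · intro u hu i
      obtain ⟨p, hp, rfl⟩ := Finset.mem_image.1 hu
      obtain ⟨hpS, rfl⟩ := Finset.mem_filter.1 hp
      obtain ⟨h1, h2, h3, -⟩ := hS p hpS
      have h1' : (1 : ℝ) ≤ p.1 := by exact_mod_cast h1
      have h2' : (p.1 : ℝ) ≤ Q := by exact_mod_cast h2
      have e : (p.2 i : ℝ) - p.1 * y i = p.1 * ((p.2 i : ℝ) / p.1 - y i) := by field_simp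
      rw [e, abs_mul, abs_of_pos (by linarith)]
      calc (p.1 : ℝ) * _ ≤ Q * 1 := by
            gcongr
            exact h3 i
        _ = Q := mul_one _
    · gcongr
      linarith
  calc (S.card : ℝ) = ∑ q ∈ Finset.Icc (1 : ℤ) Q, ((S.filter fun p => p.1 = q).card : ℝ) := by
        rw [← Nat.cast_sum, ← Finset.card_eq_sum_card_fiberwise hmaps]
    _ ≤ ∑ _q ∈ Finset.Icc (1 : ℤ) Q, (3 * (Q : ℝ)) ^ d := Finset.sum_le_sum hfib
    _ = _ := by
        rw [Finset.sum_const, nsmul_eq_mul, mul_pow]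
        simp
        ring

lemma CountBound.mono {d : ℕ} {f : (Fin d → ℝ) → ℝ} {y : Fin d → ℝ} {Q : ℕ} {δ δ' M M' : ℝ}
    (h : CountBound f y Q δ M) (hδ : δ' ≤ δ) (hM : M ≤ M') : CountBound f y Q δ' M' := by
  intro S hS
  refine (h S fun p hp => ?_).trans hM
  obtain ⟨h1, h2, h3, b, hb⟩ := hS p hp
  exact ⟨h1, h2, h3, b, hb.trans hδ⟩

theorem countBound_of_recursion {d : ℕ} {L C K A₀ : ℝ} (hC : 1 ≤ C) (hK : 2 ≤ K)
    (hstep : ∀ Q H : ℕ, 1 ≤ H → K * H ≤ Q → ∀ A₀ E : ℝ, 0 ≤ A₀ → 0 ≤ E →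
      (∀ g G, IsGradientPair L g G → ∀ y : Fin d → ℝ, ∀ X : ℕ, 1 ≤ X → X ≤ H → ∀ δ : ℝ, 0 < δ →
        CountBound g y X δ (A₀ * δ * X ^ (d + 1) + E * X ^ d)) →
      ∀ f F, IsGradientPair L f F → ∀ y : Fin d → ℝ, CountBound f y Q (1 / (32 * H))
        (C * (Q ^ (d + 1) / H + (A₀ * (H / Q) + E) * Q ^ d / √((Q : ℝ) / H) ^ (d - 2))))
    (hA₀ : 64 * C * 3 ^ d ≤ A₀) (E : ℕ → ℝ) (hE : ∀ Q, 0 ≤ E Q) (hmono : Monotone E)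
    (hrec : ∀ Q : ℕ, 1 ≤ Q → 3 ^ d * Q ≤ E Q ∨ ∃ H : ℕ, 1 ≤ H ∧ K * H ≤ Q ∧
      C * (Q / H + A₀ + E H / √((Q : ℝ) / H) ^ (d - 2)) ≤ E Q) :
    ∀ Q : ℕ, 1 ≤ Q → ∀ δ : ℝ, 0 < δ → ∀ f F, IsGradientPair L f F → ∀ y : Fin d → ℝ,
      CountBound f y Q δ (A₀ * δ * Q ^ (d + 1) + E Q * Q ^ d) := by
  have h3 : (1 : ℝ) ≤ 3 ^ d := one_le_pow₀ (by norm_num)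
  have hA1 : 64 * C ≤ A₀ := by nlinarith
  have hA3 : 64 * 3 ^ d ≤ A₀ := by nlinarith
  have hA0 : 0 ≤ A₀ := by linarith
  intro Q
  induction Q using Nat.strong_induction_on with
  | _ Q ih =>
  intro hQ δ hδ f F hfF y
  have hQR : (1 : ℝ) ≤ Q := by exact_mod_cast hQ
  have hEQ : 0 ≤ E Q * (Q : ℝ) ^ d := mul_nonneg (hE Q) (by positivity)
  rcases hrec Q hQ with htriv | ⟨H₀, hH₀, hKH₀, hH₀E⟩
  · refine (countBound_trivial f y hQ δ).mono le_rfl ?_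
    have : 0 ≤ A₀ * δ * (Q : ℝ) ^ (d + 1) := by positivity
    calc (3 : ℝ) ^ d * Q ^ (d + 1) = 3 ^ d * Q * Q ^ d := by ring
      _ ≤ E Q * Q ^ d := by gcongr
      _ ≤ _ := by linarith
  by_cases hbig : 1 / 32 < δ
  · refine (countBound_trivial f y hQ δ).mono le_rfl ?_
    have : (3 : ℝ) ^ d ≤ A₀ * δ := by nlinarith
    calc (3 : ℝ) ^ d * Q ^ (d + 1) ≤ A₀ * δ * Q ^ (d + 1) := by gcongr
      _ ≤ _ := by linarith
  push Not at hbig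
  have h1δ : 1 ≤ 1 / (32 * δ) := by
    rw [one_le_div (by positivity)]
    linarith
  set H₁ : ℕ := ⌊1 / (32 * δ)⌋₊ with hH₁
  have hH₁1 : 1 ≤ H₁ := Nat.le_floor (by exact_mod_cast h1δ)
  have hH₁u : (H₁ : ℝ) ≤ 1 / (32 * δ) := Nat.floor_le (by positivity)
  have hH₁l : 1 / (32 * δ) < H₁ + 1 := Nat.lt_floor_add_one _
  set H : ℕ := min H₀ H₁ with hH
  have hH1 : 1 ≤ H := le_min hH₀ hH₁1
  have hHR : (1 : ℝ) ≤ H := by exact_mod_cast hH1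
  have hHH₀ : H ≤ H₀ := min_le_left _ _
  have hHH₀' : (H : ℝ) ≤ H₀ := by exact_mod_cast hHH₀
  have hKH : K * H ≤ Q := (mul_le_mul_of_nonneg_left hHH₀' (by linarith)).trans hKH₀
  have hHQ : H < Q := by
    have : (H : ℝ) < Q := by nlinarith
    exact_mod_cast this
  have hH₀0 : (0 : ℝ) < H₀ := by exact_mod_cast hH₀
  have hδH : δ ≤ 1 / (32 * H) := by
    have h1 : (H : ℝ) ≤ 1 / (32 * δ) := le_trans (by exact_mod_cast min_le_right _ _) hH₁u
    rw [le_div_iff₀ (by positivity)] at h1 ⊢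
    linarith
  have hinv : (Q : ℝ) / H ≤ 64 * δ * Q + Q / H₀ := by
    have h0 : 0 ≤ (Q : ℝ) / H₀ := by positivity
    have h0' : 0 ≤ 64 * δ * Q := by positivity
    rcases min_cases H₀ H₁ with ⟨h, -⟩ | ⟨h, -⟩
    · rw [hH, h]
      linarith
    · rw [hH, h]
      have hH₁R : (1 : ℝ) ≤ H₁ := by exact_mod_cast hH₁1
      rw [div_lt_iff₀ (by positivity)] at hH₁l
      have : (Q : ℝ) / H₁ ≤ 64 * δ * Q := by
        rw [div_le_iff₀ (by linarith)]
        have : 1 ≤ 64 * δ * H₁ := by nlinarith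
        nlinarith
      linarith
  refine (hstep Q H hH1 hKH A₀ (E H) hA0 (hE H) ?_ f F hfF y).mono hδH ?_
  · intro g G hgG y X hX hXH δ hδ
    refine (ih X (by omega) hX δ hδ g G hgG y).mono le_rfl ?_
    have := hmono hXH
    gcongr
  · have hs1 : 1 ≤ √((Q : ℝ) / H₀) ^ (d - 2) := by
      refine one_le_pow₀ ?_
      rw [Real.one_le_sqrt, one_le_div hH₀0]
      nlinarith
    have hs2 : √((Q : ℝ) / H₀) ^ (d - 2) ≤ √((Q : ℝ) / H) ^ (d - 2) := by gcongr
    have e1 : (A₀ * (H / Q) + E H) / √((Q : ℝ) / H) ^ (d - 2) ≤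
        A₀ + E H₀ / √((Q : ℝ) / H₀) ^ (d - 2) := by
      rw [add_div]
      refine add_le_add ?_ ?_
      · refine (div_le_self (by positivity) (hs1.trans hs2)).trans ?_
        refine mul_le_of_le_one_right hA0 ?_
        rw [div_le_one (by linarith)]
        exact_mod_cast hHQ.le
      · have := hmono hHH₀
        have := hE H₀
        gcongr
    calc C * (Q ^ (d + 1) / H + (A₀ * (H / Q) + E H) * Q ^ d / √((Q : ℝ) / H) ^ (d - 2))
        = C * (Q / H + (A₀ * (H / Q) + E H) / √((Q : ℝ) / H) ^ (d - 2)) * Q ^ d := by ring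
      _ ≤ C * ((64 * δ * Q + Q / H₀) + (A₀ + E H₀ / √((Q : ℝ) / H₀) ^ (d - 2))) * Q ^ d := by
        gcongr
      _ = 64 * C * δ * Q ^ (d + 1)
          + C * (Q / H₀ + A₀ + E H₀ / √((Q : ℝ) / H₀) ^ (d - 2)) * Q ^ d := by ring
      _ ≤ _ := by gcongr

theorem exists_countBound_of_three_le {d : ℕ} (hd : 3 ≤ d) {L : ℝ} (hL : 1 ≤ L) :
    ∃ A M : ℝ, 0 < A ∧ 0 < M ∧ ∀ Q : ℕ, 1 ≤ Q → ∀ δ : ℝ, 0 < δ → ∀ f F, IsGradientPair L f F →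
      ∀ y : Fin d → ℝ, CountBound f y Q δ (A * δ * Q ^ (d + 1) + M * Q ^ d) := by
  obtain ⟨C, K, hC, hK, hstep⟩ := countBound_of_dual (by omega : 2 ≤ d) hL
  have hA : 0 < 64 * C * 3 ^ d := by positivity
  set A := 64 * C * 3 ^ d with hAdef
  set K' : ℝ := K + 16 * C ^ 2 with hK'
  have hK'0 : 0 < K' := by positivity
  set M : ℝ := 3 ^ d * K' + 2 * C * (2 * K' + A) with hM
  have hM0 : 0 < M := by positivity
  refine ⟨A, M, hA, hM0, ?_⟩
  refine countBound_of_recursion hC hK hstep le_rfl (fun _ => M) (fun _ => hM0.le)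
    monotone_const fun Q hQ => ?_
  rcases le_or_gt (Q : ℝ) K' with hQK | hQK
  · left
    have h1 : (3 : ℝ) ^ d * Q ≤ 3 ^ d * K' := by gcongr
    have h2 : 0 ≤ 2 * C * (2 * K' + A) := by positivity
    linarith
  · right
    have h1 : 1 ≤ (Q : ℝ) / K' := by
      rw [one_le_div hK'0]
      exact hQK.le
    set H : ℕ := ⌊(Q : ℝ) / K'⌋₊ with hH
    have hH1 : 1 ≤ H := Nat.le_floor (by exact_mod_cast h1)
    have hHR : (1 : ℝ) ≤ H := by exact_mod_cast hH1
    have hHu : (H : ℝ) ≤ Q / K' := Nat.floor_le (by positivity)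
    have hHl : (Q : ℝ) / K' < H + 1 := Nat.lt_floor_add_one _
    rw [le_div_iff₀ hK'0] at hHu
    rw [div_lt_iff₀ hK'0] at hHl
    have hC2 : 0 < C ^ 2 := by positivity
    refine ⟨H, hH1, by nlinarith, ?_⟩
    have hs : 4 * C ≤ √((Q : ℝ) / H) ^ (d - 2) := by
      have h4 : 4 * C ≤ √((Q : ℝ) / H) := by
        refine Real.le_sqrt_of_sq_le ?_
        rw [le_div_iff₀ (by linarith)]
        nlinarith
      exact h4.trans (le_self_pow₀ (by linarith) (by omega))
    have h2 : (Q : ℝ) / H ≤ 2 * K' := by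
      rw [div_le_iff₀ (by linarith)]
      nlinarith
    have h3 : M / √((Q : ℝ) / H) ^ (d - 2) ≤ M / (4 * C) := by gcongr
    calc C * (Q / H + A + M / √((Q : ℝ) / H) ^ (d - 2)) ≤ C * (2 * K' + A + M / (4 * C)) := by
          gcongr
      _ = C * (2 * K' + A) + M / 4 := by field_simp
      _ ≤ M := by
        have h5 : 0 ≤ 3 ^ d * K' := by positivity
        have h6 : 0 ≤ C * (2 * K' + A) := by positivity
        rw [hM]
        linarith

theorem exists_countBound_two {L : ℝ} (hL : 1 ≤ L) :
    ∃ A M c : ℝ, 0 < A ∧ 0 < M ∧ 0 < c ∧ ∀ Q : ℕ, 1 ≤ Q → ∀ δ : ℝ, 0 < δ →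
      ∀ f F, IsGradientPair L f F → ∀ y : Fin 2 → ℝ,
      CountBound f y Q δ (A * δ * Q ^ 3 + M * Real.exp (c * √(Real.log Q)) * Q ^ 2) := by
  obtain ⟨C, K, hC, hK, hstep⟩ := countBound_of_dual le_rfl hL
  have hA : 0 < 64 * C * 3 ^ 2 := by positivity
  set A := 64 * C * 3 ^ 2 with hAdef
  set t₀ : ℝ := max 1 (Real.log K) with ht₀
  set c : ℝ := 1 + 2 * Real.log (2 * C) with hc
  have hlog : 0 ≤ Real.log (2 * C) := Real.log_nonneg (by linarith)
  have hc1 : 1 ≤ c := by linarith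
  set M : ℝ := 9 * Real.exp (t₀ ^ 2) + 2 * C * (2 + A) with hM
  have hM0 : 0 < M := by positivity
  refine ⟨A, M, c, hA, hM0, by linarith, ?_⟩
  have hexp1 : ∀ Q : ℕ, 1 ≤ Real.exp (c * √(Real.log Q)) := fun Q =>
    Real.one_le_exp (by positivity)
  refine countBound_of_recursion hC hK hstep le_rfl (fun Q => M * Real.exp (c * √(Real.log Q)))
    (fun Q => by positivity) ?_ fun Q hQ => ?_
  · intro a b hab
    rcases Nat.eq_zero_or_pos a with rfl | ha
    · simpa using le_mul_of_one_le_right hM0.le (hexp1 b)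
    · have : (0 : ℝ) < a := by exact_mod_cast ha
      have : (a : ℝ) ≤ b := by exact_mod_cast hab
      dsimp only
      gcongr
  have hQR : (1 : ℝ) ≤ Q := by exact_mod_cast hQ
  set t : ℝ := √(Real.log Q) with ht
  have ht2 : t ^ 2 = Real.log Q := Real.sq_sqrt (Real.log_nonneg hQR)
  have hQt : (Q : ℝ) = Real.exp (t ^ 2) := by rw [ht2, Real.exp_log (by linarith)]
  have ht0 : 0 ≤ t := Real.sqrt_nonneg _
  rcases le_or_gt t t₀ with htt | htt
  · left
    have h1 : (Q : ℝ) ≤ Real.exp (t₀ ^ 2) := by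
      rw [hQt]
      gcongr
    have h2 : 0 ≤ 2 * C * (2 + A) := by positivity
    calc (3 : ℝ) ^ 2 * Q ≤ M := by linarith
      _ ≤ M * Real.exp (c * t) := le_mul_of_one_le_right hM0.le (hexp1 Q)
  · right
    have ht1 : 1 < t := (le_max_left _ _).trans_lt htt
    have hKt : K ≤ Real.exp t := by
      rw [← Real.log_le_iff_le_exp (by linarith)]
      exact ((le_max_right _ _).trans_lt htt).le
    have hQe : (Q : ℝ) / Real.exp t = Real.exp (t ^ 2 - t) := by rw [hQt, Real.exp_sub]
    have h1 : 1 ≤ (Q : ℝ) / Real.exp t := by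
      rw [hQe]
      exact Real.one_le_exp (by nlinarith)
    set H : ℕ := ⌊(Q : ℝ) / Real.exp t⌋₊ with hH
    have hH1 : 1 ≤ H := Nat.le_floor (by exact_mod_cast h1)
    have hHR : (1 : ℝ) ≤ H := by exact_mod_cast hH1
    have hHu : (H : ℝ) ≤ Q / Real.exp t := Nat.floor_le (by positivity)
    have hHl : (Q : ℝ) / Real.exp t < H + 1 := Nat.lt_floor_add_one _
    have hlogH : √(Real.log H) ≤ t - 1 / 2 := by
      rw [Real.sqrt_le_left (by linarith), Real.log_le_iff_le_exp (by linarith)]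
      refine hHu.trans ?_
      rw [hQe]
      gcongr
      nlinarith
    rw [le_div_iff₀ (Real.exp_pos t)] at hHu
    rw [div_lt_iff₀ (Real.exp_pos t)] at hHl
    refine ⟨H, hH1, by nlinarith, ?_⟩
    have h2 : (Q : ℝ) / H ≤ 2 * Real.exp t := by
      rw [div_le_iff₀ (by linarith)]
      nlinarith [Real.exp_pos t]
    have h3 : Real.exp (c * √(Real.log H)) ≤ Real.exp (c * t) / (2 * C) := by
      rw [le_div_iff₀ (by positivity), ← Real.exp_log (by positivity : 0 < 2 * C), ← Real.exp_add]
      gcongr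
      have : c * √(Real.log H) ≤ c * (t - 1 / 2) := by gcongr
      linarith
    have h4 : 1 ≤ Real.exp t := Real.one_le_exp ht0
    have h5 : Real.exp t ≤ Real.exp (c * t) := by
      gcongr
      nlinarith
    simp only [Nat.sub_self, pow_zero, div_one]
    calc C * (Q / H + A + M * Real.exp (c * √(Real.log H)))
        ≤ C * (2 * Real.exp (c * t) + A * Real.exp (c * t)
          + M * (Real.exp (c * t) / (2 * C))) := by
          gcongr
          · exact h2.trans (by linarith)
          · exact le_mul_of_one_le_right hA.le (h4.trans h5)
      _ = (C * (2 + A) + M / 2) * Real.exp (c * t) := by field_simp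
      _ ≤ M * Real.exp (c * t) := by
        gcongr
        have h6 : 0 ≤ 9 * Real.exp (t₀ ^ 2) := by positivity
        rw [hM]
        linarith

/-- The linear functional `x ↦ ∑ i, v i * x i`. -/
noncomputable def dotCLM {d : ℕ} (v : Fin d → ℝ) : (Fin d → ℝ) →L[ℝ] ℝ :=
  ∑ i, v i • ContinuousLinearMap.proj (R := ℝ) (φ := fun _ : Fin d => ℝ) i

lemma dotCLM_apply {d : ℕ} (v x : Fin d → ℝ) : dotCLM v x = ∑ i, v i * x i := by
  simp [dotCLM]

lemma norm_dotCLM_le {d : ℕ} (v : Fin d → ℝ) : ‖dotCLM v‖ ≤ d * ‖v‖ := by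
  refine ContinuousLinearMap.opNorm_le_bound _ (by positivity) fun x => ?_
  rw [dotCLM_apply]
  calc ‖∑ i, v i * x i‖ ≤ ∑ i : Fin d, ‖v‖ * ‖x‖ := by
        refine norm_sum_le_of_le _ fun i _ => ?_
        rw [norm_mul]
        gcongr <;> exact norm_le_pi_norm _ i
    _ = d * ‖v‖ * ‖x‖ := by simp [mul_assoc]

lemma dotCLM_sub {d : ℕ} (v v' : Fin d → ℝ) : dotCLM (v - v') = dotCLM v - dotCLM v' := by
  ext x
  simp [dotCLM_apply, sub_mul]

lemma exists_isGradientPair_of_approximatesLinearOn {d : ℕ} {f : (Fin d → ℝ) → ℝ}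
    {F : (Fin d → ℝ) → Fin d → ℝ} (A : (Fin d → ℝ) ≃L[ℝ] (Fin d → ℝ)) {c : NNReal}
    (hc : c < ‖(A.symm : (Fin d → ℝ) →L[ℝ] (Fin d → ℝ))‖₊⁻¹)
    (hF : ApproximatesLinearOn F (A : (Fin d → ℝ) →L[ℝ] (Fin d → ℝ)) Set.univ c)
    (hf : ∀ x, HasFDerivAt f (dotCLM (F x)) x) : ∃ L : ℝ, 1 ≤ L ∧ IsGradientPair L f F := by
  set B : ℝ := ‖(A : (Fin d → ℝ) →L[ℝ] (Fin d → ℝ))‖ + c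
  have hB : 0 ≤ B := by positivity
  obtain ⟨K, hK⟩ : ∃ K : NNReal, AntilipschitzWith K (Set.univ.domRestrict F) :=
    ⟨_, hF.antilipschitz (Or.inr hc)⟩
  have hlip : ∀ x y, ‖F y - F x‖ ≤ B * ‖y - x‖ := by
    intro x y
    have := hF.lipschitz.dist_le_mul (⟨y, trivial⟩ : (Set.univ : Set (Fin d → ℝ))) ⟨x, trivial⟩
    simpa [B, Subtype.dist_eq, dist_eq_norm] using this
  have hanti : ∀ x y, ‖y - x‖ ≤ K * ‖F y - F x‖ := by
    intro x y
    have := hK.le_mul_dist (⟨y, trivial⟩ : (Set.univ : Set (Fin d → ℝ))) ⟨x, trivial⟩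
    simpa [Subtype.dist_eq, dist_eq_norm] using this
  have htay : ∀ x y, |f y - f x - ∑ i, F x i * (y i - x i)| ≤ d * B * ‖y - x‖ ^ 2 := by
    intro x y
    have h := (convex_closedBall x ‖y - x‖).norm_image_sub_le_of_norm_hasFDerivWithin_le'
      (f := f) (f' := fun z => dotCLM (F z)) (φ := dotCLM (F x)) (C := d * B * ‖y - x‖)
      (x := x) (y := y) (fun z _ => (hf z).hasFDerivWithinAt) ?_
      (Metric.mem_closedBall_self (norm_nonneg _)) (by simp [dist_eq_norm])
    · rw [dotCLM_apply, Real.norm_eq_abs] at h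
      simpa [sq, mul_assoc] using h
    · intro z hz
      rw [← dotCLM_sub]
      refine (norm_dotCLM_le _).trans ?_
      rw [mul_assoc]
      gcongr
      refine (hlip x z).trans ?_
      gcongr
      simpa [dist_eq_norm] using hz
  have hKnn : (0 : ℝ) ≤ K := K.2
  refine ⟨1 + B + K + d * B + d * B * K ^ 2, ?_, hF.surjective (Or.inr hc), ?_, ?_, ?_, ?_⟩
  · have : 0 ≤ B + K + d * B + d * B * K ^ 2 := by positivity
    linarith
  · intro x y
    refine (hlip x y).trans ?_
    gcongr
    have : 0 ≤ 1 + K + d * B + d * B * K ^ 2 := by positivity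
    linarith
  · intro x y
    refine (hanti x y).trans ?_
    gcongr
    have : 0 ≤ 1 + B + d * B + d * B * K ^ 2 := by positivity
    linarith
  · intro x y
    refine (htay x y).trans ?_
    gcongr
    have : 0 ≤ 1 + B + K + d * B * K ^ 2 := by positivity
    linarith
  · intro x y
    refine (htay x y).trans ?_
    calc d * B * ‖y - x‖ ^ 2 ≤ d * B * (K * ‖F y - F x‖) ^ 2 := by gcongr; exact hanti x y
      _ = d * B * K ^ 2 * ‖F y - F x‖ ^ 2 := by ring
      _ ≤ _ := by
        gcongr
        have : 0 ≤ 1 + B + K + d * B := by positivity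
        linarith

/-- A smooth compactly supported cutoff of the identity function on the line. -/
lemma exists_truncation : ∃ (ψ ψ' : ℝ → ℝ) (K : ℝ), 1 ≤ K ∧ (∀ t, HasDerivAt ψ (ψ' t) t) ∧
    (∀ t, |ψ t| ≤ 2) ∧ (∀ t, |t| ≤ 1 → ψ t = t) ∧ (∀ s t, |ψ s - ψ t| ≤ K * |s - t|) ∧
    (∀ t, |ψ' t| ≤ K) ∧ ∀ s t, |ψ' s - ψ' t| ≤ K * |s - t| := by
  let χ : ContDiffBump (0 : ℝ) := ⟨1, 2, one_pos, one_lt_two⟩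
  have hχ : ContDiff ℝ (⊤ : ℕ∞) χ := χ.contDiff
  have hψ : ContDiff ℝ (⊤ : ℕ∞) fun t : ℝ => t * χ t := contDiff_id.mul hχ
  have hs : HasCompactSupport fun t : ℝ => t * χ t := χ.hasCompactSupport.mul_left
  obtain ⟨K₁, h₁⟩ := ContDiff.lipschitzWith_of_hasCompactSupport hs hψ (by simp)
  obtain ⟨hd, hψ'⟩ := contDiff_infty_iff_deriv.1 hψ
  obtain ⟨K₂, h₂⟩ := ContDiff.lipschitzWith_of_hasCompactSupport hs.deriv hψ' (by simp)
  refine ⟨fun t => t * χ t, deriv fun t => t * χ t, 1 + K₁ + K₂, ?_, fun t => (hd t).hasDerivAt,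
    ?_, ?_, ?_, ?_, ?_⟩
  · linarith [K₁.coe_nonneg, K₂.coe_nonneg]
  · intro t
    rcases le_total 2 |t| with h | h
    · have : χ t = 0 := χ.zero_of_le_dist (by simpa [χ] using h)
      simp [this]
    · rw [abs_mul, abs_of_nonneg χ.nonneg]
      exact (mul_le_of_le_one_right (abs_nonneg _) χ.le_one).trans h
  · intro t ht
    have : χ t = 1 := χ.one_of_mem_closedBall (by simpa [χ] using ht)
    simp [this]
  · intro s t
    refine (h₁.dist_le_mul s t).trans ?_
    rw [Real.dist_eq]
    gcongr
    linarith [K₂.coe_nonneg]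
  · intro t
    have := norm_deriv_le_of_lipschitz (x₀ := t) h₁
    rw [Real.norm_eq_abs] at this
    linarith [K₂.coe_nonneg]
  · intro s t
    refine (h₂.dist_le_mul s t).trans ?_
    rw [Real.dist_eq]
    gcongr
    linarith [K₁.coe_nonneg]

lemma hasFDerivAt_taylorPolynomial {d : ℕ} (g x₀ : Fin d → ℝ)
    (A : (Fin d → ℝ) →L[ℝ] (Fin d → ℝ)) (hA : ∀ u v, ∑ i, A u i * v i = ∑ i, A v i * u i)
    (x : Fin d → ℝ) :
    HasFDerivAt (fun x => ∑ i, g i * (x i - x₀ i) + 1 / 2 * ∑ i, A (x - x₀) i * (x i - x₀ i))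
      (dotCLM (g + A (x - x₀))) x := by
  have h1 : ∀ i, HasFDerivAt (fun x : Fin d → ℝ => x i - x₀ i)
      (ContinuousLinearMap.proj (R := ℝ) (φ := fun _ : Fin d => ℝ) i) x := fun i =>
    (hasFDerivAt_apply i x).sub_const _
  have h2 : ∀ i, HasFDerivAt (fun x : Fin d → ℝ => A (x - x₀) i)
      ((ContinuousLinearMap.proj (R := ℝ) (φ := fun _ : Fin d => ℝ) i).comp A) x := fun i => by
    have h3 : HasFDerivAt (fun x : Fin d → ℝ => A (x - x₀)) A x := by
      simpa using A.hasFDerivAt.comp x ((hasFDerivAt_id x).sub_const x₀)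
    exact (hasFDerivAt_apply i _).comp x h3
  refine ((HasFDerivAt.fun_sum fun i _ => (h1 i).const_mul (g i)).add
    ((HasFDerivAt.fun_sum fun i _ => (h2 i).mul (h1 i)).const_mul (1 / 2))).congr_fderiv ?_
  ext1 v
  have := hA v (x - x₀)
  simp only [Pi.sub_apply] at this
  simp only [dotCLM_apply, add_apply, sum_apply,
    smul_apply, ContinuousLinearMap.proj_apply, smul_eq_mul,
    ContinuousLinearMap.comp_apply, Finset.sum_add_distrib, Pi.add_apply, add_mul]
  have h4 : ∑ i, (x i - x₀ i) * A v i = ∑ i, A (x - x₀) i * v i := by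
    rw [← this]
    exact Finset.sum_congr rfl fun i _ => mul_comm _ _
  rw [h4]
  ring

lemma exists_isGradientPair_eqOn {d : ℕ} [NeZero d] {f : (Fin d → ℝ) → ℝ}
    {G : (Fin d → ℝ) → Fin d → ℝ} {x₀ : Fin d → ℝ} (A : (Fin d → ℝ) ≃L[ℝ] (Fin d → ℝ))
    (hA : ∀ u v, ∑ i, A u i * v i = ∑ i, A v i * u i)
    (hG : HasStrictFDerivAt G (A : (Fin d → ℝ) →L[ℝ] (Fin d → ℝ)) x₀)
    (hf : ∀ᶠ x in nhds x₀, HasFDerivAt f (dotCLM (G x)) x) :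
    ∃ ρ : ℝ, 0 < ρ ∧ ρ ≤ 1 ∧ ∃ (L : ℝ) (g : (Fin d → ℝ) → ℝ) (G' : (Fin d → ℝ) → Fin d → ℝ),
      1 ≤ L ∧ IsGradientPair L g G' ∧ ∀ x, (∀ i, |x i - x₀ i| ≤ ρ) → g x = f x := by
  obtain ⟨ψ, ψ', K, hK, hψ, hψ2, hψid, hψlip, hψ'K, hψ'lip⟩ := exists_truncation
  have hK0 : 0 < K := by linarith
  set N := ‖(A.symm : (Fin d → ℝ) →L[ℝ] (Fin d → ℝ))‖₊
  have hN : 0 < N := by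
    rcases A.subsingleton_or_nnnorm_symm_pos with h | h
    · exact absurd h (not_subsingleton _)
    · exact h
  set c : NNReal := (2 * (N + 1))⁻¹
  have hc : c < N⁻¹ := by
    refine inv_strictAnti₀ hN ?_
    rw [← NNReal.coe_lt_coe]
    push_cast
    linarith [N.coe_nonneg]
  have hc0 : 0 < c := by positivity
  obtain ⟨ε, hε0, hεc⟩ : ∃ ε : NNReal, 0 < ε ∧ 3 * K ^ 2 * ε = c := by
    have hpos : 0 < (c : ℝ) / (3 * K ^ 2) := div_pos hc0 (by positivity)
    refine ⟨Real.toNNReal (c / (3 * K ^ 2)), Real.toNNReal_pos.2 hpos, ?_⟩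
    rw [Real.coe_toNNReal _ hpos.le]
    field_simp
  obtain ⟨s, hs, hsG⟩ := hG.approximates_deriv_on_nhds (Or.inr hε0)
  obtain ⟨r, hr, hrs⟩ := Metric.nhds_basis_closedBall.mem_iff.1 (Filter.inter_mem hs hf)
  set ρ : ℝ := min 1 (r / 2)
  have hρ : 0 < ρ := lt_min one_pos (by positivity)
  have hρr : 2 * ρ ≤ r := by
    have := min_le_right 1 (r / 2)
    linarith
  set κ : (Fin d → ℝ) → Fin d → ℝ := fun x i => x₀ i + ρ * ψ ((x i - x₀ i) / ρ) with hκ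
  have hκball : ∀ x, ‖κ x - x₀‖ ≤ 2 * ρ := fun x => by
    refine (pi_norm_le_iff_of_nonneg (by positivity)).2 fun i => ?_
    simp only [hκ, Pi.sub_apply, add_sub_cancel_left, Real.norm_eq_abs, abs_mul, abs_of_pos hρ]
    rw [mul_comm]
    gcongr
    exact hψ2 _
  have hκmem : ∀ x, κ x ∈ s ∩ {x | HasFDerivAt f (dotCLM (G x)) x} := fun x =>
    hrs (by rw [Metric.mem_closedBall, dist_eq_norm]; exact (hκball x).trans hρr)
  have hscale : ∀ (x y : Fin d → ℝ) i, |(x i - x₀ i) / ρ - (y i - x₀ i) / ρ| ≤ ‖x - y‖ / ρ := by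
    intro x y i
    rw [← sub_div, abs_div, abs_of_pos hρ, sub_sub_sub_cancel_right]
    gcongr
    exact norm_le_pi_norm (x - y) i
  have hκlip : ∀ x y, ‖κ x - κ y‖ ≤ K * ‖x - y‖ := fun x y => by
    refine (pi_norm_le_iff_of_nonneg (by positivity)).2 fun i => ?_
    simp only [hκ, Pi.sub_apply, add_sub_add_left_eq_sub, ← mul_sub, Real.norm_eq_abs, abs_mul,
      abs_of_pos hρ]
    calc ρ * |ψ ((x i - x₀ i) / ρ) - ψ ((y i - x₀ i) / ρ)| ≤ ρ * (K * (‖x - y‖ / ρ)) := by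
          gcongr
          exact (hψlip _ _).trans (by gcongr; exact hscale x y i)
      _ = K * ‖x - y‖ := by field_simp
  set T : (Fin d → ℝ) → ℝ := fun x =>
    ∑ i, G x₀ i * (x i - x₀ i) + 1 / 2 * ∑ i, A (x - x₀) i * (x i - x₀ i)
  have hT : ∀ x, HasFDerivAt T (dotCLM (G x₀ + A (x - x₀))) x := fun x =>
    hasFDerivAt_taylorPolynomial (G x₀) x₀ (A : (Fin d → ℝ) →L[ℝ] (Fin d → ℝ)) hA x
  set P : (Fin d → ℝ) → Fin d → ℝ := fun x => G x - (G x₀ + A (x - x₀)) with hP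
  have hPlip : ∀ x ∈ s, ∀ y ∈ s, ‖P x - P y‖ ≤ ε * ‖x - y‖ := fun x hx y hy => by
    have := hsG x hx y hy
    have he : P x - P y = G x - G y - A (x - y) := by
      simp only [hP, map_sub]
      abel
    rw [he]
    exact this
  have hP0 : P x₀ = 0 := by simp [hP]
  have hκ' : ∀ x, HasFDerivAt κ (ContinuousLinearMap.pi fun i => ψ' ((x i - x₀ i) / ρ) •
      ContinuousLinearMap.proj (R := ℝ) (φ := fun _ : Fin d => ℝ) i) x := fun x => by
    rw [hasFDerivAt_pi]
    intro i
    have h1 : HasDerivAt (fun t : ℝ => x₀ i + ρ * ψ ((t - x₀ i) / ρ))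
        (ψ' ((x i - x₀ i) / ρ)) (x i) := by
      have h2 : HasDerivAt (fun t : ℝ => (t - x₀ i) / ρ) (1 / ρ) (x i) :=
        ((hasDerivAt_id _).sub_const _).div_const _
      have := (((hψ ((x i - x₀ i) / ρ)).comp (x i) h2).const_mul ρ).const_add (x₀ i)
      convert! this using 1
      field_simp
    exact HasDerivAt.comp_hasFDerivAt (f := fun x : Fin d → ℝ => x i) x h1 (hasFDerivAt_apply i x)
  set G' : (Fin d → ℝ) → Fin d → ℝ := fun x =>
    G x₀ + A (x - x₀) + fun i => P (κ x) i * ψ' ((x i - x₀ i) / ρ) with hG'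
  have hder : ∀ x, HasFDerivAt (fun x => T x + (f (κ x) - T (κ x))) (dotCLM (G' x)) x := fun x => by
    have h1 := (((hκmem x).2.sub (hT (κ x))).comp x (hκ' x))
    refine ((hT x).add h1).congr_fderiv ?_
    ext1 v
    simp only [hG', hP, dotCLM_apply, add_apply, ContinuousLinearMap.comp_apply,
      sub_apply, ContinuousLinearMap.pi_apply, smul_apply,
      ContinuousLinearMap.proj_apply, smul_eq_mul, Pi.add_apply, Pi.sub_apply,
      ← Finset.sum_add_distrib, ← Finset.sum_sub_distrib]
    exact Finset.sum_congr rfl fun i _ => by ring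
  have happrox : ApproximatesLinearOn G' (A : (Fin d → ℝ) →L[ℝ] (Fin d → ℝ)) Set.univ c := by
    intro x _ y _
    refine (pi_norm_le_iff_of_nonneg (by positivity)).2 fun i => ?_
    have he : (G' x - G' y - (A : (Fin d → ℝ) →L[ℝ] (Fin d → ℝ)) (x - y)) i =
        (P (κ x) - P (κ y)) i * ψ' ((x i - x₀ i) / ρ) +
          P (κ y) i * (ψ' ((x i - x₀ i) / ρ) - ψ' ((y i - x₀ i) / ρ)) := by
      simp only [hG', Pi.sub_apply, Pi.add_apply, map_sub, ContinuousLinearEquiv.coe_coe]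
      ring
    have h1 : |(P (κ x) - P (κ y)) i| ≤ ε * (K * ‖x - y‖) :=
      (norm_le_pi_norm (P (κ x) - P (κ y)) i).trans
        ((hPlip _ (hκmem x).1 _ (hκmem y).1).trans (by gcongr; exact hκlip x y))
    have h2 : |P (κ y) i| ≤ ε * (2 * ρ) := by
      have := hPlip _ (hκmem y).1 x₀ (mem_of_mem_nhds hs)
      rw [hP0, sub_zero] at this
      exact (norm_le_pi_norm (P (κ y)) i).trans (this.trans (by gcongr; exact hκball y))
    have h3 : |ψ' ((x i - x₀ i) / ρ) - ψ' ((y i - x₀ i) / ρ)| ≤ K * (‖x - y‖ / ρ) :=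
      (hψ'lip _ _).trans (by gcongr; exact hscale x y i)
    rw [he, Real.norm_eq_abs]
    calc _ ≤ ε * (K * ‖x - y‖) * K + ε * (2 * ρ) * (K * (‖x - y‖ / ρ)) := by
          refine (abs_add_le _ _).trans ?_
          rw [abs_mul, abs_mul]
          gcongr
          exact hψ'K _
      _ = (K * K + 2 * K) * ε * ‖x - y‖ := by field_simp
      _ ≤ 3 * K ^ 2 * ε * ‖x - y‖ := by
          gcongr
          nlinarith
      _ = c * ‖x - y‖ := by rw [hεc]
  obtain ⟨L, hL, hpair⟩ := exists_isGradientPair_of_approximatesLinearOn A hc happrox hder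
  refine ⟨ρ, hρ, min_le_left _ _, L, _, G', hL, hpair, fun x hx => ?_⟩
  have hfix : κ x = x := by
    ext i
    simp only [hκ]
    rw [hψid _ (by rw [abs_div, abs_of_pos hρ]; exact div_le_one_of_le₀ (hx i) hρ.le)]
    field_simp
    ring
  simp only [hfix]
  ring

lemma eq_dotCLM {d : ℕ} (φ : (Fin d → ℝ) →L[ℝ] ℝ) : φ = dotCLM fun i => φ (Pi.single i 1) := by
  ext1 v
  conv_lhs => rw [pi_eq_sum_univ' v]
  rw [map_sum, dotCLM_apply]
  exact Finset.sum_congr rfl fun i _ => by rw [map_smul, smul_eq_mul, mul_comm]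

lemma exists_isGradientPair_of_contDiffAt {d : ℕ} [NeZero d] {f : (Fin d → ℝ) → ℝ}
    {x₀ : Fin d → ℝ} (hf : ContDiffAt ℝ 2 f x₀) (hdet : (hess f x₀).det ≠ 0) :
    ∃ ρ : ℝ, 0 < ρ ∧ ρ ≤ 1 ∧ ∃ (L : ℝ) (g : (Fin d → ℝ) → ℝ) (G : (Fin d → ℝ) → Fin d → ℝ),
      1 ≤ L ∧ IsGradientPair L g G ∧ ∀ x, (∀ i, |x i - x₀ i| ≤ ρ) → g x = f x := by
  have hf' : HasStrictFDerivAt (fderiv ℝ f) (fderiv ℝ (fderiv ℝ f) x₀) x₀ :=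
    (hf.fderiv_right (m := 1) (by norm_num)).hasStrictFDerivAt (by norm_num)
  have hsymm : IsSymmSndFDerivAt ℝ f x₀ := hf.isSymmSndFDerivAt (by simp)
  set Φ : ((Fin d → ℝ) →L[ℝ] ℝ) →L[ℝ] (Fin d → ℝ) := ContinuousLinearMap.pi fun i =>
    ContinuousLinearMap.apply ℝ ℝ (Pi.single i (1 : ℝ))
  set A₀ : (Fin d → ℝ) →L[ℝ] (Fin d → ℝ) := Φ.comp (fderiv ℝ (fderiv ℝ f) x₀)
  have hG : HasStrictFDerivAt (gradv f) A₀ x₀ := Φ.hasStrictFDerivAt.comp x₀ hf'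
  have hhess : ∀ i j, hess f x₀ i j = A₀ (Pi.single i 1) j := by
    intro i j
    have h1 : HasFDerivAt (fun y => fderiv ℝ f y (Pi.single j 1))
        ((ContinuousLinearMap.proj j).comp A₀) x₀ := hasFDerivAt_pi'.1 hG.hasFDerivAt j
    simp only [hess, Matrix.of_apply, h1.fderiv]
    rfl
  have hdetA : A₀.det ≠ 0 := by
    have : LinearMap.toMatrix' (A₀ : (Fin d → ℝ) →ₗ[ℝ] (Fin d → ℝ)) = (hess f x₀).transpose := by
      ext i j
      rw [Matrix.transpose_apply, hhess, LinearMap.toMatrix'_apply]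
      rfl
    rwa [ContinuousLinearMap.det, ← LinearMap.det_toMatrix', this, Matrix.det_transpose]
  refine exists_isGradientPair_eqOn (G := gradv f) (x₀ := x₀)
    (A₀.toContinuousLinearEquivOfDetNeZero hdetA) ?_ ?_ ?_
  · have hA : ∀ u v, ∑ i, A₀ u i * v i = fderiv ℝ (fderiv ℝ f) x₀ u v := by
      intro u v
      rw [eq_dotCLM (fderiv ℝ (fderiv ℝ f) x₀ u), dotCLM_apply]
      rfl
    intro u v
    simp only [ContinuousLinearMap.toContinuousLinearEquivOfDetNeZero_apply, hA]
    exact hsymm u v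
  · simpa using hG
  · have h2 : ∀ᶠ x in nhds x₀, ContDiffAt ℝ 2 f x := hf.eventually (by simp)
    filter_upwards [h2] with x hx
    have h3 := (hx.differentiableAt (by norm_num)).hasFDerivAt
    rwa [eq_dotCLM (fderiv ℝ f x)] at h3

/-- The error term in the counting estimate for rational points near a hypersurface in
`ℝ ^ (d + 1)`. -/
noncomputable def errorTerm (d : ℕ) (c Q : ℝ) : ℝ :=
  if d = 2 then Q ^ 2 * Real.exp (c * √(Real.log Q)) else Q ^ d

lemma errorTerm_nonneg (d : ℕ) (c : ℝ) {Q : ℝ} (hQ : 0 ≤ Q) : 0 ≤ errorTerm d c Q := by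
  unfold errorTerm
  split_ifs <;> positivity

lemma errorTerm_mono (d : ℕ) {c c' Q Q' : ℝ} (hc : 0 ≤ c) (hc' : c ≤ c') (hQ : 1 ≤ Q)
    (hQ' : Q ≤ Q') : errorTerm d c Q ≤ errorTerm d c' Q' := by
  have := hc.trans hc'
  unfold errorTerm
  split_ifs <;> gcongr

lemma exists_countBound {d : ℕ} (hd : 2 ≤ d) {L : ℝ} (hL : 1 ≤ L) :
    ∃ C c : ℝ, 0 < C ∧ 0 < c ∧ ∀ Q : ℕ, 1 ≤ Q → ∀ δ : ℝ, 0 < δ →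
      ∀ (f : (Fin d → ℝ) → ℝ) (F : (Fin d → ℝ) → Fin d → ℝ), IsGradientPair L f F →
        ∀ y, CountBound f y Q δ (C * (δ * Q ^ (d + 1) + errorTerm d c Q)) := by
  have combine : ∀ {A M x y : ℝ}, 0 < A → 0 < M → 0 ≤ x → 0 ≤ y →
      A * x + M * y ≤ max A M * (x + y) := by
    intro A M x y hA hM hx hy
    rw [mul_add]
    gcongr
    · exact le_max_left _ _
    · exact le_max_right _ _
  rcases hd.eq_or_lt with rfl | hd
  · obtain ⟨A, M, c, hA, hM, hc, h⟩ := exists_countBound_two hL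
    refine ⟨max A M, c, lt_max_of_lt_left hA, hc, fun Q hQ δ hδ f F hF y =>
      (h Q hQ δ hδ f F hF y).mono le_rfl ?_⟩
    have := combine hA hM (x := δ * Q ^ 3) (by positivity)
      (errorTerm_nonneg 2 c (Nat.cast_nonneg Q))
    refine le_trans (le_of_eq ?_) this
    rw [errorTerm, if_pos rfl]
    ring
  · obtain ⟨A, M, hA, hM, h⟩ := exists_countBound_of_three_le hd hL
    refine ⟨max A M, 1, lt_max_of_lt_left hA, one_pos, fun Q hQ δ hδ f F hF y =>
      (h Q hQ δ hδ f F hF y).mono le_rfl ?_⟩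
    have := combine hA hM (x := δ * Q ^ (d + 1)) (by positivity)
      (errorTerm_nonneg d 1 (Nat.cast_nonneg Q))
    refine le_trans (le_of_eq ?_) this
    rw [errorTerm, if_neg (by omega)]
    ring

/-- The expected estimate holds for the rational points near the graph of `f` over `s`. -/
def SatisfiesCountBound {d : ℕ} (f : (Fin d → ℝ) → ℝ) (s : Set (Fin d → ℝ)) : Prop :=
  ∃ C c : ℝ, 0 < C ∧ 0 < c ∧ ∀ Q : ℕ, 1 ≤ Q → ∀ δ : ℝ, 0 < δ →
    ∀ S : Finset (ℤ × (Fin d → ℤ)), (∀ p ∈ S, 1 ≤ p.1 ∧ p.1 ≤ Q ∧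
      (fun i => (p.2 i : ℝ) / p.1) ∈ s ∧
      ∃ b : ℤ, |(p.1 : ℝ) * f (fun i => (p.2 i : ℝ) / p.1) - b| ≤ δ) →
      (S.card : ℝ) ≤ C * (δ * Q ^ (d + 1) + errorTerm d c Q)

lemma SatisfiesCountBound.mono {d : ℕ} {f : (Fin d → ℝ) → ℝ} {s t : Set (Fin d → ℝ)}
    (hst : s ⊆ t) (h : SatisfiesCountBound f t) : SatisfiesCountBound f s := by
  obtain ⟨C, c, hC, hc, h⟩ := h
  exact ⟨C, c, hC, hc, fun Q hQ δ hδ S hS => h Q hQ δ hδ S fun p hp =>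
    ⟨(hS p hp).1, (hS p hp).2.1, hst (hS p hp).2.2.1, (hS p hp).2.2.2⟩⟩

lemma SatisfiesCountBound.union {d : ℕ} {f : (Fin d → ℝ) → ℝ} {s t : Set (Fin d → ℝ)}
    (hs : SatisfiesCountBound f s) (ht : SatisfiesCountBound f t) :
    SatisfiesCountBound f (s ∪ t) := by
  classical
  obtain ⟨C₁, c₁, hC₁, hc₁, h₁⟩ := hs
  obtain ⟨C₂, c₂, hC₂, hc₂, h₂⟩ := ht
  refine ⟨C₁ + C₂, max c₁ c₂, by positivity, lt_max_of_lt_left hc₁, fun Q hQ δ hδ S hS => ?_⟩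
  have hQR : (1 : ℝ) ≤ Q := by exact_mod_cast hQ
  have k₁ := h₁ Q hQ δ hδ (S.filter fun p => (fun i => (p.2 i : ℝ) / p.1) ∈ s) fun p hp => by
    obtain ⟨hpS, hps⟩ := Finset.mem_filter.1 hp
    exact ⟨(hS p hpS).1, (hS p hpS).2.1, hps, (hS p hpS).2.2.2⟩
  have k₂ := h₂ Q hQ δ hδ (S.filter fun p => (fun i => (p.2 i : ℝ) / p.1) ∉ s) fun p hp => by
    obtain ⟨hpS, hps⟩ := Finset.mem_filter.1 hp
    exact ⟨(hS p hpS).1, (hS p hpS).2.1, (hS p hpS).2.2.1.resolve_left hps, (hS p hpS).2.2.2⟩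
  have e₁ : errorTerm d c₁ Q ≤ errorTerm d (max c₁ c₂) Q :=
    errorTerm_mono d hc₁.le (le_max_left _ _) hQR le_rfl
  have e₂ : errorTerm d c₂ Q ≤ errorTerm d (max c₁ c₂) Q :=
    errorTerm_mono d hc₂.le (le_max_right _ _) hQR le_rfl
  rw [← Finset.card_filter_add_card_filter_not (s := S)
    fun p => (fun i => (p.2 i : ℝ) / p.1) ∈ s, Nat.cast_add, add_mul]
  gcongr
  · exact k₁.trans (by gcongr)
  · exact k₂.trans (by gcongr)

lemma satisfiesCountBound_empty {d : ℕ} (f : (Fin d → ℝ) → ℝ) : SatisfiesCountBound f ∅ := by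
  refine ⟨1, 1, one_pos, one_pos, fun Q hQ δ hδ S hS => ?_⟩
  have : S = ∅ := Finset.eq_empty_of_forall_notMem fun p hp => (hS p hp).2.2.1
  have := errorTerm_nonneg d 1 (Nat.cast_nonneg Q)
  subst S
  rw [Finset.card_empty, Nat.cast_zero]
  positivity

lemma satisfiesCountBound_of_isCompact {d : ℕ} (hd : 2 ≤ d) {f : (Fin d → ℝ) → ℝ}
    {K : Set (Fin d → ℝ)} (hK : IsCompact K) (hf : ∀ x ∈ K, ContDiffAt ℝ 2 f x)
    (hdet : ∀ x ∈ K, (hess f x).det ≠ 0) : SatisfiesCountBound f K := by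
  have : NeZero d := ⟨by omega⟩
  refine hK.induction_on (satisfiesCountBound_empty f) (fun s t hst => .mono hst)
    (fun s t => .union) fun x hx => ?_
  obtain ⟨ρ, hρ, hρ1, L, g, G, hL, hg, hgf⟩ :=
    exists_isGradientPair_of_contDiffAt (hf x hx) (hdet x hx)
  obtain ⟨C, c, hC, hc, h⟩ := exists_countBound hd hL
  refine ⟨Metric.closedBall x ρ, mem_nhdsWithin_of_mem_nhds (Metric.closedBall_mem_nhds x hρ),
    C, c, hC, hc, fun Q hQ δ hδ S hS => h Q hQ δ hδ g G hg x S fun p hp => ?_⟩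
  obtain ⟨h1, h2, h3, h4⟩ := hS p hp
  have hnear : ∀ i, |(p.2 i : ℝ) / p.1 - x i| ≤ ρ := fun i =>
    (norm_le_pi_norm ((fun i => (p.2 i : ℝ) / p.1) - x) i).trans
      (by rwa [Metric.mem_closedBall, dist_eq_norm] at h3)
  refine ⟨h1, h2, fun i => (hnear i).trans hρ1, ?_⟩
  rwa [hgf _ hnear]

lemma NSw_le {d : ℕ} {f w : (Fin d → ℝ) → ℝ} (hw : Continuous w) (hwc : HasCompactSupport w)
    (h : SatisfiesCountBound f (tsupport w)) :
    ∃ C c : ℝ, 0 < C ∧ 0 < c ∧ ∀ Q δ : ℝ, 1 ≤ Q → 0 < δ →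
      NSw f w Q δ ≤ C * (δ * Q ^ (d + 1) + errorTerm d c Q) := by
  classical
  obtain ⟨C, c, hC, hc, h⟩ := h
  obtain ⟨W, hW⟩ := hwc.exists_bound_of_continuous hw
  have hW0 : 0 ≤ W := (norm_nonneg _).trans (hW 0)
  obtain ⟨R, hR⟩ := hwc.isCompact.isBounded.exists_norm_le
  refine ⟨C * (W + 1), c, by positivity, hc, fun Q δ hQ hδ => ?_⟩
  have hQ0 : 0 ≤ Q := by linarith
  have hQ1 : 1 ≤ ⌊Q⌋₊ := Nat.le_floor (by exact_mod_cast hQ)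
  have hQ1R : (1 : ℝ) ≤ ⌊Q⌋₊ := by exact_mod_cast hQ1
  have hQle : (⌊Q⌋₊ : ℝ) ≤ Q := Nat.floor_le hQ0
  set g : ℤ → (Fin d → ℤ) → ℝ := fun q a =>
    if 1 ≤ q ∧ (q : ℝ) ≤ Q ∧ nint ((q : ℝ) * f (fun i => (a i : ℝ) / (q : ℝ))) < δ
      then w (fun i => (a i : ℝ) / (q : ℝ)) else 0 with hg
  have hgne : ∀ q a, g q a ≠ 0 → (1 ≤ q ∧ q ≤ (⌊Q⌋₊ : ℤ) ∧
      (fun i => (a i : ℝ) / (q : ℝ)) ∈ tsupport w ∧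
      ∃ b : ℤ, |(q : ℝ) * f (fun i => (a i : ℝ) / q) - b| ≤ δ) := by
    intro q a hqa
    simp only [hg, ne_eq, ite_eq_right_iff, Classical.not_imp] at hqa
    obtain ⟨⟨h1, h2, h3⟩, h4⟩ := hqa
    refine ⟨h1, ?_, subset_tsupport w h4, _, h3.le⟩
    rw [Int.natCast_floor_eq_floor hQ0]
    exact Int.le_floor.2 h2
  set B : ℤ := ⌈Q * R⌉
  set box : Finset (Fin d → ℤ) := Fintype.piFinset fun _ => Finset.Icc (-B) B
  have hbox : ∀ q a, g q a ≠ 0 → a ∈ box := by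
    intro q a hqa
    obtain ⟨h1, h2, h3, -⟩ := hgne q a hqa
    refine Fintype.mem_piFinset.2 fun i => ?_
    have hq0 : (0 : ℝ) < q := by exact_mod_cast h1
    have hqQ : (q : ℝ) ≤ Q := le_trans (by exact_mod_cast h2) hQle
    have h5 : |(a i : ℝ) / q| ≤ R := (norm_le_pi_norm (fun i => (a i : ℝ) / (q : ℝ)) i).trans
      (hR _ h3)
    have hR0 : 0 ≤ R := (abs_nonneg _).trans h5
    rw [abs_div, abs_of_pos hq0, div_le_iff₀ hq0] at h5
    have h6 : |(a i : ℝ)| ≤ B := calc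
      |(a i : ℝ)| ≤ R * q := h5
      _ ≤ R * Q := by gcongr
      _ = Q * R := mul_comm _ _
      _ ≤ B := Int.le_ceil _
    rw [Finset.mem_Icc, ← abs_le]
    exact_mod_cast h6
  have hsum : NSw f w Q δ = ∑ p ∈ Finset.Icc 1 (⌊Q⌋₊ : ℤ) ×ˢ box, g p.1 p.2 := by
    have hin : ∀ q, ∑ᶠ a, g q a = ∑ a ∈ box, g q a := fun q =>
      finsum_eq_sum_of_support_subset _ fun a ha => hbox q a ha
    rw [Finset.sum_product]
    change ∑ᶠ q, ∑ᶠ a, g q a = _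
    simp only [hin]
    refine finsum_eq_sum_of_support_subset _ fun q hq => ?_
    obtain ⟨a, -, ha⟩ := Finset.exists_ne_zero_of_sum_ne_zero hq
    exact Finset.mem_coe.2 (Finset.mem_Icc.2 ⟨(hgne q a ha).1, (hgne q a ha).2.1⟩)
  set S := (Finset.Icc 1 (⌊Q⌋₊ : ℤ) ×ˢ box).filter fun p => g p.1 p.2 ≠ 0
  have hS := h ⌊Q⌋₊ hQ1 δ hδ S fun p hp => hgne p.1 p.2 (Finset.mem_filter.1 hp).2
  rw [hsum, ← Finset.sum_filter_ne_zero]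
  have hgW : ∀ q a, g q a ≤ W := fun q a => by
    simp only [hg]
    split_ifs
    · exact (le_abs_self _).trans (hW _)
    · exact hW0
  calc ∑ p ∈ S, g p.1 p.2 ≤ S.card * W := by
        rw [← nsmul_eq_mul]
        exact Finset.sum_le_card_nsmul _ _ _ fun p _ => hgW _ _
    _ ≤ C * (δ * (⌊Q⌋₊ : ℝ) ^ (d + 1) + errorTerm d c ⌊Q⌋₊) * (W + 1) := by
        have := errorTerm_nonneg d c (Nat.cast_nonneg ⌊Q⌋₊)
        gcongr
        linarith
    _ ≤ C * (δ * Q ^ (d + 1) + errorTerm d c Q) * (W + 1) := by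
        have := errorTerm_mono d hc.le le_rfl hQ1R hQle
        gcongr
    _ = _ := by ring

theorem statement1 (n : ℕ) (hn : 3 ≤ n) (l : ℕ)
    (hl : l = max ((n - 1) / 2 + 5) (n + 1))
    (D : Set (Fin (n - 1) → ℝ)) (hDopen : IsOpen D)
    (hDbdd : Bornology.IsBounded D) (hDconn : IsConnected D)
    (f : (Fin (n - 1) → ℝ) → ℝ) (hf : ContDiffOn ℝ (l : ℕ∞) f D)
    (c₁ c₂ : ℝ) (hc₁ : 0 < c₁)
    (hHess : ∀ x ∈ D, c₁ ≤ |(hess f x).det| ∧ |(hess f x).det| ≤ c₂)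
    -- `∇f : D → ∇f(D)` is a diffeomorphism
    (hdiffeo : Set.InjOn (gradv f) D)
    (w : (Fin (n - 1) → ℝ) → ℝ) (hw : ContDiff ℝ (⊤ : ℕ∞) w)
    (hwc : HasCompactSupport w) (hwD : tsupport w ⊆ D) :
    ∃ c > (0 : ℝ), ∃ κ > (0 : ℝ), ∃ C > (0 : ℝ), ∀ Q δ : ℝ, 2 ≤ Q → 0 < δ → δ < 1 / 2 →
      NSw f w Q δ ≤ C * (δ * Q ^ n +
        (if n = 3 then Q ^ 2 * Real.exp (c * Real.sqrt (Real.log Q))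
         else Q ^ (n - 1) * Real.log Q ^ κ)) := by
  have hl2 : (2 : WithTop ℕ∞) ≤ ((l : ℕ∞) : WithTop ℕ∞) := by
    have : (2 : ℕ∞) ≤ l := by
      have : 2 ≤ l := by omega
      exact_mod_cast this
    exact WithTop.coe_le_coe.2 this
  obtain ⟨C, c, hC, hc, h⟩ := NSw_le hw.continuous hwc
    (satisfiesCountBound_of_isCompact (by omega) hwc.isCompact
      (fun x hx => ((hf x (hwD hx)).contDiffAt (hDopen.mem_nhds (hwD hx))).of_le hl2)
      fun x hx => abs_pos.1 (hc₁.trans_le (hHess x (hwD hx)).1))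
  refine ⟨c, hc, 1, one_pos, C * 2, by positivity, fun Q δ hQ hδ _ => ?_⟩
  refine (h Q δ (by linarith) hδ).trans ?_
  rw [mul_assoc C 2, Nat.sub_add_cancel (by omega : 1 ≤ n)]
  have h1 : 0 ≤ δ * Q ^ n := by positivity
  have h2 : errorTerm (n - 1) c Q ≤ 2 * (if n = 3 then Q ^ 2 * Real.exp (c * √(Real.log Q))
      else Q ^ (n - 1) * Real.log Q ^ (1 : ℝ)) := by
    by_cases hn3 : n = 3
    · rw [errorTerm, if_pos (by omega), if_pos hn3]
      have : 0 ≤ Q ^ 2 * Real.exp (c * √(Real.log Q)) := by positivity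
      linarith
    · rw [errorTerm, if_neg (by omega), if_neg hn3, Real.rpow_one]
      have hlog : 1 / 2 ≤ Real.log Q := by
        have := Real.log_le_log two_pos hQ
        linarith [Real.log_two_gt_d9]
      have : 0 ≤ Q ^ (n - 1) := by positivity
      nlinarith
  gcongr
  linarith
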